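/- arXiv:1309.0124 — 4 statements merged into one kernel-verified Lean document; each statement's English description precedes it below -/
import Mathlib

section
/- If for each n, G_n is an acyclic finite simple graph (a forest) on n vertices, then the graph Stirling sequence ({G_n brace k})_{k ∈ ℤ} is asymptotically normal. -/
/-- Total mass of a sequence indexed by `ℤ`. -/
noncomputable def seqTotal (a : ℤ → ℝ) : ℝ := ∑ᶠ k, a k

/-- The probability mass function obtained by normalizing the sequence `a`. -/
noncomputable def seqPMF (a : ℤ → ℝ) (k : ℤ) : ℝ := a k / seqTotal a

/-- The mean of the random variable `X` with `P(X = k) = a k / Σ_j a j`. -/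
noncomputable def seqMean (a : ℤ → ℝ) : ℝ := ∑ᶠ k : ℤ, (k : ℝ) * seqPMF a k

/-- The standard deviation of the random variable `X` with `P(X = k) = a k / Σ_j a j`. -/
noncomputable def seqStdDev (a : ℤ → ℝ) : ℝ :=
  Real.sqrt (∑ᶠ k : ℤ, ((k : ℝ) - seqMean a) ^ 2 * seqPMF a k)

/-- `P((X - μ)/σ ≤ x)` for the random variable `X` with `P(X = k) = a k / Σ_j a j`. -/
noncomputable def seqNormalizedCDF (a : ℤ → ℝ) (x : ℝ) : ℝ :=
  ∑ᶠ k ∈ {k : ℤ | ((k : ℝ) - seqMean a) / seqStdDev a ≤ x}, seqPMF a k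

/-- The cumulative distribution function of the standard normal distribution. -/
noncomputable def stdNormalCDF (x : ℝ) : ℝ :=
  ∫ t in Set.Iio x, Real.exp (-(t ^ 2) / 2) / Real.sqrt (2 * Real.pi)

/-- A family of non-negative sequences `(a n k)_{k ∈ ℤ}` is asymptotically normal if the
normalized random variable `(X_n - μ_n)/σ_n` converges in distribution to a standard normal. -/
def AsymptoticallyNormal (a : ℕ → ℤ → ℝ) : Prop :=
  ∀ x : ℝ, Filter.Tendsto (fun n => seqNormalizedCDF (a n) x)
    Filter.atTop (nhds (stdNormalCDF x))
/-- `graphStirling G k` is the number of partitions of the vertex set of `G` into `k`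
non-empty independent sets. -/
noncomputable def graphStirling {V : Type*} (G : SimpleGraph V) (k : ℕ) : ℕ :=
  Nat.card {P : Finset (Finset V) // P.card = k ∧ (∀ p ∈ P, p.Nonempty) ∧
    (∀ v : V, ∃! p, p ∈ P ∧ v ∈ p) ∧ ∀ p ∈ P, ∀ u ∈ p, ∀ v ∈ p, ¬ G.Adj u v}

open SimpleGraph in
/-- A finite nonempty forest has a vertex with at most one neighbour. -/
theorem SimpleGraph.IsAcyclic.exists_forall_adj_eq {V : Type*} [Finite V] [Nonempty V]
    {G : SimpleGraph V} (hG : G.IsAcyclic) : ∃ v w, ∀ x, G.Adj v x → x = w := by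
  classical
  have := Fintype.ofFinite V
  let S : Set ℕ := {l | ∃ u v, ∃ p : G.Walk u v, p.IsPath ∧ p.length = l}
  have hne : S.Nonempty := ⟨0, Classical.arbitrary V, _, Walk.nil, by simp, rfl⟩
  have hfin : S.Finite := (Set.finite_lt_nat (Fintype.card V)).subset (by
    rintro l ⟨u, v, p, hp, rfl⟩
    exact hp.length_lt)
  obtain ⟨l, ⟨u, v, p, hp, hl⟩, hmax⟩ := hfin.exists_maximal hne
  refine ⟨u, p.snd, fun x hx => ?_⟩
  refine hG.eq_snd_of_adj_start hp hx ?_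
  by_contra hxs
  have h := hmax ⟨x, v, Walk.cons hx.symm p, hp.cons hxs, rfl⟩
  simp at h
  omega

/-- Colourings of a graph are colourings of a vertex-deleted subgraph together with
an admissible colour for the deleted vertex. -/
def SimpleGraph.coloringEquivSigma {V α : Type*} [DecidableEq V] (G : SimpleGraph V) (v : V) :
    G.Coloring α ≃ Σ f : (G.induce {v}ᶜ).Coloring α,
      {c : α // ∀ x : ({v}ᶜ : Set V), G.Adj v x → c ≠ f x} where
  toFun f := ⟨SimpleGraph.Coloring.mk (fun x => f x) (fun h => f.valid h),
    ⟨f v, fun _ hx => f.valid hx⟩⟩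
  invFun p := SimpleGraph.Coloring.mk
    (fun x => if hx : x = v then p.2.1 else p.1 ⟨x, hx⟩) (by
      intro x y hxy
      by_cases hx : x = v <;> by_cases hy : y = v
      · subst hx; subst hy; exact (G.loopless.irrefl _ hxy).elim
      · subst hx; simpa [hy] using p.2.2 ⟨y, hy⟩ hxy
      · subst hy; simpa [hx] using (p.2.2 ⟨x, hx⟩ hxy.symm).symm
      · simpa [hx, hy] using p.1.valid (v := ⟨x, hx⟩) (w := ⟨y, hy⟩) hxy)
  left_inv f := by
    ext x
    by_cases hx : x = v
    · subst hx; simp [SimpleGraph.Coloring.mk]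
    · simp [SimpleGraph.Coloring.mk, hx]
  right_inv p := by
    obtain ⟨f, c, hc⟩ := p
    have h : (SimpleGraph.Coloring.mk (fun x : ({v}ᶜ : Set V) =>
        if hx : (x : V) = v then c else f ⟨x, hx⟩) (by
          intro x y hxy
          have hx : (x : V) ≠ v := x.2
          have hy : (y : V) ≠ v := y.2
          simpa [hx, hy] using f.valid hxy) : (G.induce {v}ᶜ).Coloring α) = f := by
      ext x
      have hx : (x : V) ≠ v := x.2
      simp [SimpleGraph.Coloring.mk, hx]
    refine Sigma.subtype_ext h ?_
    simp [SimpleGraph.Coloring.mk]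

/-- The number of proper `q`-colourings of a forest is `q ^ c * (q - 1) ^ m`. -/
theorem SimpleGraph.IsAcyclic.exists_card_coloring (n : ℕ) :
    ∀ {V : Type} [Fintype V] {G : SimpleGraph V}, G.IsAcyclic → Fintype.card V = n →
      ∃ c m : ℕ, c + m = n ∧ (m ≠ 0 → c ≠ 0) ∧
        ∀ q : ℕ, Nat.card (G.Coloring (Fin q)) = q ^ c * (q - 1) ^ m := by
  classical
  induction n with
  | zero =>
    intro V _ G hG hV
    have := Fintype.card_eq_zero_iff.1 hV
    refine ⟨0, 0, rfl, by simp, fun q => ?_⟩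
    have : Unique (G.Coloring (Fin q)) :=
      { default := SimpleGraph.Coloring.mk (fun x => isEmptyElim x) (fun {x} => isEmptyElim x)
        uniq := fun f => by ext x; exact isEmptyElim x }
    simp
  | succ n ih =>
    intro V _ G hG hV
    have : Nonempty V := Fintype.card_pos_iff.1 (by omega)
    obtain ⟨v, w, hvw⟩ := hG.exists_forall_adj_eq
    obtain ⟨c, m, hcm, hmc, hcard⟩ := ih (hG.induce {v}ᶜ) (by
      rw [← Nat.card_eq_fintype_card, Nat.card_coe_set_eq, Set.ncard_compl,
        Nat.card_eq_fintype_card]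
      simp [hV])
    have key (q : ℕ) : Nat.card (G.Coloring (Fin q)) =
        ∑ f : (G.induce {v}ᶜ).Coloring (Fin q),
          Nat.card {c : Fin q // ∀ x : ({v}ᶜ : Set V), G.Adj v x → c ≠ f x} := by
      rw [Nat.card_congr (G.coloringEquivSigma v), Nat.card_sigma]
    by_cases h : G.Adj v w
    · refine ⟨c, m + 1, by omega, fun _ hc => ?_, fun q => ?_⟩
      · have hm : m = 0 := by by_contra hm; exact hmc hm hc
        have : 1 < Fintype.card V := Fintype.one_lt_card_iff.2 ⟨v, w, h.ne⟩
        omega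
      · have h1 (f : (G.induce {v}ᶜ).Coloring (Fin q)) :
            Nat.card {c : Fin q // ∀ x : ({v}ᶜ : Set V), G.Adj v x → c ≠ f x} = q - 1 := by
          have : ∀ c : Fin q, (∀ x : ({v}ᶜ : Set V), G.Adj v x → c ≠ f x) ↔
              c ∈ ({f ⟨w, h.ne'⟩}ᶜ : Set (Fin q)) := by
            intro c
            constructor
            · intro hc; exact hc ⟨w, h.ne'⟩ h
            · rintro hc ⟨x, hx⟩ hvx
              obtain rfl := hvw x hvx
              exact hc
          rw [Nat.card_congr (Equiv.subtypeEquivRight this)]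
          change Nat.card ({f ⟨w, h.ne'⟩}ᶜ : Set (Fin q)) = _
          rw [Nat.card_coe_set_eq, Set.ncard_compl]
          simp
        rw [key, Finset.sum_congr rfl fun f _ => h1 f, Finset.sum_const, Finset.card_univ,
          ← Nat.card_eq_fintype_card, hcard, smul_eq_mul]
        ring
    · have h0 : ∀ x, ¬ G.Adj v x := fun x hx => h (hvw x hx ▸ hx)
      refine ⟨c + 1, m, by omega, by simp, fun q => ?_⟩
      have h1 (f : (G.induce {v}ᶜ).Coloring (Fin q)) :
          Nat.card {c : Fin q // ∀ x : ({v}ᶜ : Set V), G.Adj v x → c ≠ f x} = q := by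
        simp [h0]
      rw [key, Finset.sum_congr rfl fun f _ => h1 f, Finset.sum_const, Finset.card_univ,
        ← Nat.card_eq_fintype_card, hcard, smul_eq_mul]
      ring

/-- A partition of the vertex set of `G` into non-empty independent sets. -/
def IsIndepPartition {V : Type*} (G : SimpleGraph V) (P : Finset (Finset V)) : Prop :=
  (∀ p ∈ P, p.Nonempty) ∧ (∀ v : V, ∃! p, p ∈ P ∧ v ∈ p) ∧
    ∀ p ∈ P, ∀ u ∈ p, ∀ v ∈ p, ¬ G.Adj u v

namespace IsIndepPartition

variable {V α : Type*} {G : SimpleGraph V} {P : Finset (Finset V)}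

/-- The block of a partition containing a given vertex. -/
noncomputable def block (hP : IsIndepPartition G P) (v : V) : P :=
  ⟨(hP.2.1 v).choose, (hP.2.1 v).choose_spec.1.1⟩

theorem mem_block (hP : IsIndepPartition G P) (v : V) : v ∈ (hP.block v : Finset V) :=
  (hP.2.1 v).choose_spec.1.2

theorem block_eq (hP : IsIndepPartition G P) {v : V} (p : P) (hv : v ∈ (p : Finset V)) :
    hP.block v = p :=
  Subtype.ext ((hP.2.1 v).choose_spec.2 p ⟨p.2, hv⟩).symm

theorem block_surjective (hP : IsIndepPartition G P) : Function.Surjective hP.block := by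
  intro p
  obtain ⟨v, hv⟩ := hP.1 p p.2
  exact ⟨v, hP.block_eq p hv⟩

/-- The colouring assigning to each vertex the label of its block. -/
noncomputable def coloring (hP : IsIndepPartition G P) (g : P ↪ α) : G.Coloring α :=
  SimpleGraph.Coloring.mk (fun v => g (hP.block v)) (by
    intro u v huv h
    have h' := g.injective h
    exact hP.2.2 _ (hP.block u).2 u (hP.mem_block u) v (h' ▸ hP.mem_block v) huv)

theorem coloring_apply (hP : IsIndepPartition G P) (g : P ↪ α) (v : V) :
    hP.coloring g v = g (hP.block v) := rfl

theorem mem_iff [Fintype V] [DecidableEq α] (hP : IsIndepPartition G P) (g : P ↪ α)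
    (p : Finset V) : p ∈ P ↔ ∃ v, p = ({u | hP.coloring g u = hP.coloring g v} : Finset V) := by
  have key (v : V) :
      ({u | hP.coloring g u = hP.coloring g v} : Finset V) = hP.block v := by
    ext u
    rw [Finset.mem_filter_univ, coloring_apply, coloring_apply, g.injective.eq_iff]
    exact ⟨fun h => h ▸ hP.mem_block u, fun h => hP.block_eq _ h⟩
  simp only [key]
  constructor
  · intro hp
    obtain ⟨v, hv⟩ := hP.block_surjective ⟨p, hp⟩
    exact ⟨v, by rw [hv]⟩
  · rintro ⟨v, rfl⟩
    exact (hP.block v).2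

end IsIndepPartition

open IsIndepPartition in
theorem bijective_sigma_coloring {V α : Type*} [Finite V] (G : SimpleGraph V) :
    Function.Bijective (fun x : Σ P : {P : Finset (Finset V) // IsIndepPartition G P}, (P.1 ↪ α) =>
      x.1.2.coloring x.2) := by
  classical
  have := Fintype.ofFinite V
  constructor
  · rintro ⟨⟨P, hP⟩, g⟩ ⟨⟨Q, hQ⟩, h⟩ hgh
    simp only at hgh
    have hPQ : P = Q := by
      ext p
      rw [hP.mem_iff g, hQ.mem_iff h, hgh]
    subst hPQ
    have : g = h := by
      ext p
      obtain ⟨v, rfl⟩ := hP.block_surjective p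
      exact DFunLike.congr_fun hgh v
    rw [this]
  · intro f
    let P : Finset (Finset V) := Finset.univ.image fun v => ({u | f u = f v} : Finset V)
    have hmem (p : Finset V) : p ∈ P ↔ ∃ v, ({u | f u = f v} : Finset V) = p := by simp [P]
    have hP : IsIndepPartition G P := by
      refine ⟨?_, fun v => ⟨({u | f u = f v} : Finset V), ?_, ?_⟩, ?_⟩
      · simp only [hmem]
        rintro _ ⟨v, rfl⟩
        exact ⟨v, by simp⟩
      · simp [hmem]
      · simp only [hmem]
        rintro _ ⟨⟨w, rfl⟩, hv⟩
        simp only [Finset.mem_filter, Finset.mem_univ, true_and] at hv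
        simp [hv]
      · simp only [hmem]
        rintro _ ⟨w, rfl⟩ u hu v hv huv
        simp only [Finset.mem_filter, Finset.mem_univ, true_and] at hu hv
        exact f.valid huv (hu.trans hv.symm)
    have hb (v : V) : (hP.block v : Finset V) = ({u | f u = f v} : Finset V) := by
      rw [hP.block_eq ⟨({u | f u = f v} : Finset V), (hmem _).2 ⟨v, rfl⟩⟩ (by simp)]
    have hrep (p : P) : ∃ v, hP.block v = p := hP.block_surjective p
    choose r hr using hrep
    have hfr (v : V) : f (r (hP.block v)) = f v := by
      have h := hP.mem_block v
      rw [← hr (hP.block v), hb] at h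
      rw [Finset.mem_filter_univ] at h
      exact h.symm
    refine ⟨⟨⟨P, hP⟩, ⟨fun p => f (r p), fun p q hpq => ?_⟩⟩, ?_⟩
    · rw [← hr p, ← hr q]
      apply Subtype.ext
      rw [hb, hb]
      simp only at hpq
      rw [hpq]
    · ext v
      exact hfr v

/-- Counting proper colourings by their number of colour classes. -/
theorem card_coloring_eq_sum_graphStirling {V : Type*} [Fintype V] (G : SimpleGraph V) (q : ℕ) :
    Nat.card (G.Coloring (Fin q)) =
      ∑ k ∈ Finset.range (Fintype.card (Finset V) + 1), graphStirling G k * q.descFactorial k := by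
  classical
  rw [← Nat.card_congr (Equiv.ofBijective _ (bijective_sigma_coloring (α := Fin q) G)),
    Nat.card_sigma]
  have h1 (P : {P : Finset (Finset V) // IsIndepPartition G P}) :
      Nat.card (P.1 ↪ Fin q) = q.descFactorial P.1.card := by
    simp [Nat.card_eq_fintype_card, Fintype.card_embedding_eq]
  simp only [h1]
  rw [← Finset.sum_fiberwise_of_maps_to (t := Finset.range (Fintype.card (Finset V) + 1))
    (g := fun P : {P : Finset (Finset V) // IsIndepPartition G P} => P.1.card)]
  · refine Finset.sum_congr rfl fun k _ => ?_
    rw [Finset.sum_congr rfl (g := fun _ => q.descFactorial k)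
      (fun P hP => by rw [(Finset.mem_filter.1 hP).2]), Finset.sum_const, smul_eq_mul]
    congr 1
    rw [graphStirling, ← Fintype.card_subtype, ← Nat.card_eq_fintype_card]
    refine Nat.card_congr
      ((Equiv.subtypeSubtypeEquivSubtypeInter (IsIndepPartition G) fun P => P.card = k).trans
      (Equiv.subtypeEquivRight fun P => ?_))
    simp only [IsIndepPartition]
    tauto
  · intro P _
    have := Finset.card_le_univ P.1
    simp only [Finset.mem_range]
    omega

theorem graphStirling_eq_zero {V : Type*} [Fintype V] (G : SimpleGraph V) {k : ℕ}
    (hk : Fintype.card (Finset V) < k) : graphStirling G k = 0 := by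
  rw [graphStirling, Nat.card_eq_zero]
  left
  constructor
  rintro ⟨P, hP, -⟩
  have := Finset.card_le_univ P
  omega

open Polynomial in
/-- The linear functional sending `X ^ k` to the falling factorial `q (q - 1) ⋯ (q - k + 1)`. -/
noncomputable def fallingEval (q : ℕ) : ℝ[X] →ₗ[ℝ] ℝ :=
  Polynomial.lsum fun k => (q.descFactorial k : ℝ) • LinearMap.id

open Polynomial in
/-- The operator on polynomials corresponding to multiplication by `q - a`
under `fallingEval`. -/
noncomputable def touchardStep (a : ℝ) (S : ℝ[X]) : ℝ[X] := X * (S + derivative S) - C a * S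

section TouchardStep

open Polynomial

theorem fallingEval_monomial (q k : ℕ) (b : ℝ) :
    fallingEval q (monomial k b) = q.descFactorial k * b := by
  simp [fallingEval, Polynomial.lsum_apply, Polynomial.sum_monomial_index]

theorem fallingEval_touchardStep (q : ℕ) (a : ℝ) (S : ℝ[X]) :
    fallingEval q (touchardStep a S) = (q - a) * fallingEval q S := by
  induction S using Polynomial.induction_on' with
  | add S T hS hT =>
    have : touchardStep a (S + T) = touchardStep a S + touchardStep a T := by
      simp only [touchardStep, derivative_add]; ring
    rw [this, map_add, hS, hT, map_add]; ring
  | monomial k b =>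
    have h1 : X * monomial k b = monomial (k + 1) b := X_mul_monomial k b
    have h2 : X * derivative (monomial k b) = monomial k (b * k) := by
      rw [derivative_monomial]
      cases k with
      | zero => simp
      | succ k => simp [X_mul_monomial]
    rw [touchardStep, mul_add, h1, h2, C_mul_monomial, map_sub, map_add]
    simp only [fallingEval_monomial, Nat.descFactorial_succ]
    rcases le_or_gt k q with h | h
    · push_cast [Nat.cast_sub h]; ring
    · simp [Nat.descFactorial_of_lt h]

theorem fallingEval_iterate_touchardStep (q : ℕ) (a : ℝ) (m : ℕ) (S : ℝ[X]) :
    fallingEval q ((touchardStep a)^[m] S) = (q - a) ^ m * fallingEval q S := by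
  induction m with
  | zero => simp
  | succ m ih => rw [Function.iterate_succ_apply', fallingEval_touchardStep, ih]; ring

/-- A polynomial is determined by its values under all `fallingEval q`. -/
theorem eq_zero_of_fallingEval_eq_zero {S : ℝ[X]} (h : ∀ q, fallingEval q S = 0) : S = 0 := by
  ext k
  rw [coeff_zero]
  induction k using Nat.strong_induction_on with
  | _ k ih =>
    have hk := h k
    rw [fallingEval, Polynomial.lsum_apply, Polynomial.sum_def, Finset.sum_eq_single k] at hk
    · simpa [Nat.descFactorial_self, Nat.factorial_ne_zero] using hk
    · intro j _ hj
      rcases lt_or_gt_of_ne hj with hj | hj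
      · simp [ih j hj]
      · simp [Nat.descFactorial_of_lt hj]
    · intro hk
      simp [notMem_support_iff.1 hk]

/-- Dobinski's formula. -/
theorem hasSum_fallingEval_div_factorial (S : ℝ[X]) :
    HasSum (fun q : ℕ => fallingEval q S / q.factorial) (Real.exp 1 * S.eval 1) := by
  induction S using Polynomial.induction_on' with
  | add S T hS hT =>
    simpa [add_div, mul_add] using hS.add hT
  | monomial k b =>
    have h1 : HasSum (fun q : ℕ => b * (1 / (q.factorial : ℝ))) (b * Real.exp 1) := by
      have := NormedSpace.expSeries_div_hasSum_exp (𝔸 := ℝ) 1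
      rw [← Real.exp_eq_exp_ℝ] at this
      simpa using this.mul_left b
    have hz : ∑ q ∈ Finset.range k, fallingEval q (monomial k b) / q.factorial = 0 := by
      refine Finset.sum_eq_zero fun q hq => ?_
      simp [fallingEval_monomial, Nat.descFactorial_of_lt (Finset.mem_range.1 hq)]
    rw [← hasSum_nat_add_iff' k, hz]
    have h2 : (fun q : ℕ => fallingEval (q + k) (monomial k b) / (q + k).factorial) =
        fun q : ℕ => b * (1 / (q.factorial : ℝ)) := by
      ext q
      have h2 := Nat.factorial_mul_descFactorial (Nat.le_add_left k q)
      rw [Nat.add_sub_cancel] at h2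
      have h3 : ((q + k).descFactorial k : ℝ) ≠ 0 := by
        simp [Nat.descFactorial_eq_zero_iff_lt]
      rw [fallingEval_monomial, ← h2]
      push_cast
      field_simp
    rw [h2, eval_monomial, one_pow, mul_one, sub_zero, mul_comm]
    exact h1

/-- The roots of `S` are real and nonpositive. -/
def HasNonposRoots (S : ℝ[X]) : Prop := ∀ z ∈ Complex.slitPlane, aeval z S ≠ 0

theorem sum_div_sub_im_nonneg {s : Multiset ℂ} (hs : ∀ r ∈ s, r ∉ Complex.slitPlane) (z : ℂ) :
    0 ≤ (s.map fun r => z / (z - r)).sum.im * z.im := by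
  induction s using Multiset.induction_on with
  | empty => simp
  | cons r s ih =>
    have ih := ih fun r hr => hs r (Multiset.mem_cons_of_mem hr)
    have hr := hs r (Multiset.mem_cons_self r s)
    rw [Complex.mem_slitPlane_iff, not_or, not_not, not_lt] at hr
    rw [Multiset.map_cons, Multiset.sum_cons, Complex.add_im, add_mul]
    refine add_nonneg ?_ ih
    have : (z / (z - r)).im * z.im = (-r.re) * z.im ^ 2 / Complex.normSq (z - r) := by
      rw [Complex.div_im]; simp [hr.2]; ring
    rw [this]
    have := Complex.normSq_nonneg (z - r)
    have : 0 ≤ - r.re := by linarith [hr.1]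
    positivity

theorem sum_div_sub_re_nonneg {s : Multiset ℂ} (hs : ∀ r ∈ s, r ∉ Complex.slitPlane) {x : ℝ}
    (hx : 0 < x) : 0 ≤ (s.map fun r => (x : ℂ) / (x - r)).sum.re := by
  induction s using Multiset.induction_on with
  | empty => simp
  | cons r s ih =>
    have ih := ih fun r hr => hs r (Multiset.mem_cons_of_mem hr)
    have hr := hs r (Multiset.mem_cons_self r s)
    rw [Complex.mem_slitPlane_iff, not_or, not_not, not_lt] at hr
    rw [Multiset.map_cons, Multiset.sum_cons, Complex.add_re]
    refine add_nonneg ?_ ih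
    rw [Complex.div_re]
    have := Complex.normSq_nonneg (x - r)
    have : 0 ≤ x - r.re := by linarith [hr.1]
    simp [hr.2]
    positivity

theorem one_le_sum_div_sub_re {s : Multiset ℂ} (hs : ∀ r ∈ s, r ∉ Complex.slitPlane) {x : ℝ}
    (hx : 0 < x) (h0 : 0 ∈ s) : 1 ≤ (s.map fun r => (x : ℂ) / (x - r)).sum.re := by
  obtain ⟨t, rfl⟩ := Multiset.exists_cons_of_mem h0
  have h := sum_div_sub_re_nonneg (fun r hr => hs r (Multiset.mem_cons_of_mem hr)) hx
  have hx' : (x : ℂ) ≠ 0 := by exact_mod_cast hx.ne'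
  simpa [div_self hx'] using h

theorem HasNonposRoots.notMem_slitPlane {S : ℝ[X]} (hS : HasNonposRoots S) {r : ℂ}
    (hr : r ∈ (S.map (algebraMap ℝ ℂ)).roots) : r ∉ Complex.slitPlane := by
  intro h
  have := (mem_roots'.1 hr).2
  rw [IsRoot.def, eval_map_algebraMap] at this
  exact hS r h this

theorem HasNonposRoots.ne_zero {S : ℝ[X]} (hS : HasNonposRoots S) : S ≠ 0 := by
  rintro rfl
  exact hS 1 (by simp) (by simp)

theorem HasNonposRoots.touchardStep {S : ℝ[X]} (hS : HasNonposRoots S) {a : ℝ}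
    (ha : a ≤ 0 ∨ a ≤ 1 ∧ S.eval 0 = 0) : HasNonposRoots (touchardStep a S) := by
  intro z hz
  set p := S.map (algebraMap ℝ ℂ) with hp
  have hpz : p.eval z ≠ 0 := by rw [hp, eval_map_algebraMap]; exact hS z hz
  have hlog := (IsAlgClosed.splits p).eval_derivative_div_eval_of_ne_zero hpz
  have hs : ∀ r ∈ p.roots, r ∉ Complex.slitPlane := fun r hr => hS.notMem_slitPlane hr
  have hsum : (p.roots.map fun r => z / (z - r)).sum = z * (p.derivative.eval z / p.eval z) := by
    rw [hlog, ← Multiset.sum_map_mul_left]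
    simp [div_eq_mul_inv]
  have hval : aeval z (_root_.touchardStep a S) =
      p.eval z * (z + (p.roots.map fun r => z / (z - r)).sum - a) := by
    have hd : p.derivative.eval z = aeval z (derivative S) := by
      rw [hp, derivative_map, eval_map_algebraMap]
    have he : p.eval z = aeval z S := by rw [hp, eval_map_algebraMap]
    rw [hsum, hd]
    rw [he] at hpz ⊢
    simp only [_root_.touchardStep, map_sub, map_mul, map_add, aeval_X, aeval_C]
    field_simp
    simp
  rw [hval]
  refine mul_ne_zero hpz fun h => ?_
  by_cases him : z.im = 0
  · obtain ⟨x, rfl⟩ : ∃ x : ℝ, z = x := ⟨z.re, Complex.ext rfl (by simpa using him)⟩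
    have hx : 0 < x := by simpa [Complex.mem_slitPlane_iff] using hz
    have h := congrArg Complex.re h
    simp only [Complex.sub_re, Complex.add_re, Complex.ofReal_re, Complex.zero_re] at h
    rcases ha with ha | ⟨ha, hS0⟩
    · linarith [sum_div_sub_re_nonneg hs hx]
    · have h0 : (0 : ℂ) ∈ p.roots := by
        rw [mem_roots']
        refine ⟨fun h0 => hpz (by simp [h0]), ?_⟩
        rw [IsRoot.def, hp, ← coeff_zero_eq_eval_zero, coeff_map, coeff_zero_eq_eval_zero, hS0,
          map_zero]
      linarith [one_le_sum_div_sub_re hs hx h0]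
  · have h := congrArg Complex.im h
    simp only [Complex.sub_im, Complex.add_im, Complex.ofReal_im, Complex.zero_im] at h
    have h1 := sum_div_sub_im_nonneg hs z
    have h2 : 0 < z.im ^ 2 := by positivity
    rw [show (p.roots.map fun r => z / (z - r)).sum.im = -z.im by linarith] at h1
    nlinarith

theorem eval_zero_touchardStep (a : ℝ) (S : ℝ[X]) :
    (touchardStep a S).eval 0 = -a * S.eval 0 := by
  simp [touchardStep]

theorem hasNonposRoots_iterate_touchardStep_zero (c : ℕ) :
    HasNonposRoots ((touchardStep 0)^[c] 1) := by
  induction c with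
  | zero => intro z _; simp
  | succ c ih =>
    rw [Function.iterate_succ_apply']
    exact ih.touchardStep (Or.inl le_rfl)

theorem hasNonposRoots_iterate_touchardStep {c m : ℕ} (h : m ≠ 0 → c ≠ 0) :
    HasNonposRoots ((touchardStep 1)^[m] ((touchardStep 0)^[c] 1)) := by
  have key (hc : c ≠ 0) (m : ℕ) :
      HasNonposRoots ((touchardStep 1)^[m] ((touchardStep 0)^[c] 1)) ∧
        ((touchardStep 1)^[m] ((touchardStep 0)^[c] 1)).eval 0 = 0 := by
    induction m with
    | zero =>
      refine ⟨hasNonposRoots_iterate_touchardStep_zero c, ?_⟩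
      obtain ⟨c, rfl⟩ := Nat.exists_eq_succ_of_ne_zero hc
      rw [Function.iterate_zero_apply, Function.iterate_succ_apply', eval_zero_touchardStep]
      simp
    | succ m ih =>
      rw [Function.iterate_succ_apply']
      exact ⟨ih.1.touchardStep (Or.inr ⟨le_rfl, ih.2⟩), by simp [eval_zero_touchardStep, ih.2]⟩
  by_cases hc : c = 0
  · have hm : m = 0 := by by_contra hm; exact h hm hc
    subst hm
    exact hasNonposRoots_iterate_touchardStep_zero c
  · exact (key hc m).1

/-- The probability generating function of a sum of independent Bernoulli variables with
success probabilities `ps`. -/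
noncomputable def bernoulliPoly (ps : Multiset ℝ) : ℝ[X] :=
  (ps.map fun p => C (1 - p) + C p * X).prod

theorem prod_X_sub_C_eq_bernoulliPoly {s : Multiset ℝ} (hs : ∀ r ∈ s, r ≤ 0) :
    (s.map fun r => X - C r).prod =
      C (s.map fun r => 1 - r).prod * bernoulliPoly (s.map fun r => (1 - r)⁻¹) := by
  induction s using Multiset.induction_on with
  | empty => simp [bernoulliPoly]
  | cons r s ih =>
    have ih := ih fun r hr => hs r (Multiset.mem_cons_of_mem hr)
    have hr := hs r (Multiset.mem_cons_self r s)
    have h1 : X - C r = C (1 - r) * (C (1 - (1 - r)⁻¹) + C (1 - r)⁻¹ * X) := by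
      have h : 1 - r ≠ 0 := by linarith
      rw [mul_add, ← mul_assoc, ← C_mul, ← C_mul, mul_sub, mul_inv_cancel₀ h, mul_one]
      simp
      ring
    simp only [bernoulliPoly, Multiset.map_cons, Multiset.prod_cons] at ih ⊢
    rw [ih, h1, C_mul]
    ring

theorem bernoulliPoly_cons (p : ℝ) (ps : Multiset ℝ) :
    bernoulliPoly (p ::ₘ ps) = (C (1 - p) + C p * X) * bernoulliPoly ps := by
  simp [bernoulliPoly]

theorem eval_one_bernoulliPoly (ps : Multiset ℝ) : (bernoulliPoly ps).eval 1 = 1 := by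
  induction ps using Multiset.induction_on with
  | empty => simp [bernoulliPoly]
  | cons p ps ih => simp [bernoulliPoly_cons, ih]

theorem eval_one_derivative_bernoulliPoly (ps : Multiset ℝ) :
    (derivative (bernoulliPoly ps)).eval 1 = ps.sum := by
  induction ps using Multiset.induction_on with
  | empty => simp [bernoulliPoly]
  | cons p ps ih => simp [bernoulliPoly_cons, ih, eval_one_bernoulliPoly, -map_sub]

theorem eval_one_derivative_derivative_bernoulliPoly (ps : Multiset ℝ) :
    (derivative (derivative (bernoulliPoly ps))).eval 1 =
      ps.sum ^ 2 - (ps.map fun p => p ^ 2).sum := by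
  induction ps using Multiset.induction_on with
  | empty => simp [bernoulliPoly]
  | cons p ps ih =>
    simp [bernoulliPoly_cons, ih, eval_one_derivative_bernoulliPoly, -map_sub]
    ring

theorem HasNonposRoots.exists_eq_bernoulliPoly {S : ℝ[X]} (hS : HasNonposRoots S) :
    ∃ ps : Multiset ℝ, (∀ p ∈ ps, 0 ≤ p ∧ p ≤ 1) ∧ S = C (S.eval 1) * bernoulliPoly ps := by
  set p := S.map (algebraMap ℝ ℂ) with hp
  set rs := p.roots.map Complex.re with hrs
  have hnp : ∀ r ∈ rs, r ≤ 0 := by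
    intro r hr
    obtain ⟨z, hz, rfl⟩ := Multiset.mem_map.1 hr
    have := hS.notMem_slitPlane hz
    rw [Complex.mem_slitPlane_iff, not_or, not_lt] at this
    exact this.1
  have hprod : S = C S.leadingCoeff * (rs.map fun r => X - C r).prod := by
    apply Polynomial.map_injective (algebraMap ℝ ℂ) (algebraMap ℝ ℂ).injective
    have h := (IsAlgClosed.splits p).eq_prod_roots
    rw [← hp, h, Polynomial.map_mul, Polynomial.map_multiset_prod, Multiset.map_map, hrs,
      Multiset.map_map, map_C, hp, leadingCoeff_map]
    congr 2
    refine Multiset.map_congr rfl fun z hz => ?_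
    have := hS.notMem_slitPlane hz
    rw [Complex.mem_slitPlane_iff, not_or, not_not] at this
    have hz' : z = (z.re : ℂ) := Complex.ext rfl (by simpa using this.2)
    simp [← hz']
  refine ⟨rs.map fun r => (1 - r)⁻¹, ?_, ?_⟩
  · intro q hq
    obtain ⟨r, hr, rfl⟩ := Multiset.mem_map.1 hq
    have := hnp r hr
    exact ⟨inv_nonneg.2 (by linarith), inv_le_one_of_one_le₀ (by linarith)⟩
  · rw [prod_X_sub_C_eq_bernoulliPoly hnp, ← mul_assoc, ← C_mul] at hprod
    have h1 : S.eval 1 = S.leadingCoeff * (rs.map fun r => 1 - r).prod := by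
      conv_lhs => rw [hprod]
      simp [eval_one_bernoulliPoly]
    rw [h1]
    exact hprod

end TouchardStep

section BernoulliCLT

open Polynomial

theorem norm_prod_sub_prod_le_sum_norm_sub {ι : Type*} (s : Multiset ι) {f g : ι → ℂ}
    (hf : ∀ i ∈ s, ‖f i‖ ≤ 1) (hg : ∀ i ∈ s, ‖g i‖ ≤ 1) :
    ‖(s.map f).prod - (s.map g).prod‖ ≤ (s.map fun i => ‖f i - g i‖).sum := by
  suffices h : ‖(s.map g).prod‖ ≤ 1 ∧
      ‖(s.map f).prod - (s.map g).prod‖ ≤ (s.map fun i => ‖f i - g i‖).sum from h.2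
  induction s using Multiset.induction_on with
  | empty => simp
  | cons i s ih =>
    obtain ⟨ih1, ih2⟩ := ih (fun j hj => hf j (Multiset.mem_cons_of_mem hj))
      (fun j hj => hg j (Multiset.mem_cons_of_mem hj))
    have hfi := hf i (Multiset.mem_cons_self i s)
    have hgi := hg i (Multiset.mem_cons_self i s)
    simp only [Multiset.map_cons, Multiset.prod_cons, Multiset.sum_cons]
    constructor
    · rw [norm_mul]
      exact mul_le_one₀ hgi (norm_nonneg _) ih1
    · have : f i * (s.map f).prod - g i * (s.map g).prod =
          f i * ((s.map f).prod - (s.map g).prod) + (f i - g i) * (s.map g).prod := by ring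
      rw [this]
      refine (norm_add_le _ _).trans ?_
      rw [norm_mul, norm_mul, add_comm]
      refine add_le_add (mul_le_of_le_one_right (norm_nonneg _) ih1) ?_
      exact (mul_le_of_le_one_left (norm_nonneg _) hfi).trans ih2

theorem norm_exp_mul_I_sub_taylor_le {x : ℝ} (hx : |x| ≤ 1) :
    ‖Complex.exp (x * Complex.I) - (1 + x * Complex.I - x ^ 2 / 2)‖ ≤ |x| ^ 3 := by
  have hn : ‖(x * Complex.I : ℂ)‖ = |x| := by simp
  have h := Complex.exp_bound (x := x * Complex.I) (by rw [hn]; exact hx) (n := 3) (by norm_num)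
  rw [hn] at h
  have h2 : ∑ m ∈ Finset.range 3, (x * Complex.I : ℂ) ^ m / (m.factorial : ℂ) =
      1 + x * Complex.I - x ^ 2 / 2 := by
    simp [Finset.sum_range_succ, mul_pow, Nat.factorial]
    ring
  rw [h2] at h
  refine h.trans ?_
  norm_num [Nat.factorial]
  have : 0 ≤ |x| ^ 3 := by positivity
  linarith

theorem norm_bernoulli_charFun_le {p : ℝ} (h0 : 0 ≤ p) (h1 : p ≤ 1) (s : ℝ) :
    ‖((1 - p : ℝ) + (p : ℝ) * Complex.exp (s * Complex.I)) *
      Complex.exp (-(s * p : ℝ) * Complex.I)‖ ≤ 1 := by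
  rw [norm_mul]
  have h2 := Complex.norm_exp_ofReal_mul_I (-(s * p))
  rw [Complex.ofReal_neg] at h2
  rw [h2, mul_one]
  refine (norm_add_le _ _).trans ?_
  rw [norm_mul, Complex.norm_exp_ofReal_mul_I, Complex.norm_real, Complex.norm_real,
    Real.norm_of_nonneg h0, Real.norm_of_nonneg (by linarith)]
  linarith

theorem norm_bernoulli_charFun_sub_exp_le {p : ℝ} (h0 : 0 ≤ p) (h1 : p ≤ 1) {s : ℝ}
    (hs : |s| ≤ 1) :
    ‖((1 - p : ℝ) + (p : ℝ) * Complex.exp (s * Complex.I)) *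
      Complex.exp (-(s * p : ℝ) * Complex.I) - (Real.exp (-(p * (1 - p)) * s ^ 2 / 2) : ℝ)‖ ≤
      2 * (p * (1 - p)) * |s| ^ 3 := by
  have hq : 0 ≤ 1 - p := by linarith
  have hp2 : |-(s * p)| = |s| * p := by rw [abs_neg, abs_mul, abs_of_nonneg h0]
  have hq2 : |s * (1 - p)| = |s| * (1 - p) := by rw [abs_mul, abs_of_nonneg hq]
  have hs0 := abs_nonneg s
  have e1 := norm_exp_mul_I_sub_taylor_le (x := -(s * p)) (by rw [hp2]; nlinarith)
  have e2 := norm_exp_mul_I_sub_taylor_le (x := s * (1 - p)) (by rw [hq2]; nlinarith)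
  rw [hp2] at e1
  rw [hq2] at e2
  have hv : p * (1 - p) ≤ 1 := by nlinarith
  have hv0 : 0 ≤ p * (1 - p) := by positivity
  have hs2 : s ^ 2 = |s| ^ 2 := (sq_abs s).symm
  have hs21 : s ^ 2 ≤ 1 := by rw [hs2]; nlinarith
  set y : ℝ := -(p * (1 - p)) * s ^ 2 / 2 with hy
  have e3 : |Real.exp y - 1 - y| ≤ y ^ 2 := by
    refine Real.abs_exp_sub_one_sub_id_le ?_
    rw [abs_le, hy]
    constructor <;> nlinarith [sq_nonneg s]
  have hf : ((1 - p : ℝ) + (p : ℝ) * Complex.exp (s * Complex.I)) *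
      Complex.exp (-(s * p : ℝ) * Complex.I) =
      (1 - p : ℝ) * Complex.exp ((-(s * p) : ℝ) * Complex.I) +
        (p : ℝ) * Complex.exp ((s * (1 - p) : ℝ) * Complex.I) := by
    rw [add_mul, mul_assoc (p : ℂ), ← Complex.exp_add]
    push_cast
    ring_nf
  have hdecomp : ((1 - p : ℝ) + (p : ℝ) * Complex.exp (s * Complex.I)) *
      Complex.exp (-(s * p : ℝ) * Complex.I) - (Real.exp y : ℝ) =
      (1 - p : ℝ) * (Complex.exp ((-(s * p) : ℝ) * Complex.I) -
        (1 + (-(s * p) : ℝ) * Complex.I - ((-(s * p) : ℝ) : ℂ) ^ 2 / 2)) +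
      (p : ℝ) * (Complex.exp ((s * (1 - p) : ℝ) * Complex.I) -
        (1 + (s * (1 - p) : ℝ) * Complex.I - ((s * (1 - p) : ℝ) : ℂ) ^ 2 / 2)) -
      ((Real.exp y - 1 - y : ℝ) : ℂ) := by
    rw [hf, hy]
    push_cast
    ring
  rw [hdecomp]
  refine (norm_sub_le _ _).trans ((add_le_add (norm_add_le _ _) le_rfl).trans ?_)
  rw [norm_mul, norm_mul, Complex.norm_real, Complex.norm_real, Complex.norm_real,
    Real.norm_of_nonneg h0, Real.norm_of_nonneg hq, Real.norm_eq_abs]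
  have f1 := mul_le_mul_of_nonneg_left e1 hq
  have f2 := mul_le_mul_of_nonneg_left e2 h0
  have f3 : (1 - p) * (|s| * p) ^ 3 + p * (|s| * (1 - p)) ^ 3 ≤ (p * (1 - p)) * |s| ^ 3 := by
    have : (1 - p) * (|s| * p) ^ 3 + p * (|s| * (1 - p)) ^ 3 =
        (p * (1 - p)) * |s| ^ 3 * (1 - 2 * (p * (1 - p))) := by ring
    rw [this]
    exact mul_le_of_le_one_right (by positivity) (by linarith)
  have f4 : y ^ 2 ≤ (p * (1 - p)) * |s| ^ 3 := by
    have : y ^ 2 = (p * (1 - p)) * |s| ^ 3 * ((p * (1 - p)) * |s| / 4) := by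
      rw [hy, hs2]; ring
    rw [this]
    refine mul_le_of_le_one_right (by positivity) ?_
    nlinarith
  linarith

/-- Quantitative Gaussian approximation of the characteristic function of a sum of independent
centred Bernoulli variables. -/
theorem norm_charFun_bernoulliPoly_sub_exp_le {ps : Multiset ℝ} (hps : ∀ p ∈ ps, 0 ≤ p ∧ p ≤ 1)
    {s : ℝ} (hs : |s| ≤ 1) :
    ‖aeval (Complex.exp (s * Complex.I)) (bernoulliPoly ps) *
      Complex.exp (-(s * ps.sum : ℝ) * Complex.I) -
        (Real.exp (-(ps.map fun p => p * (1 - p)).sum * s ^ 2 / 2) : ℝ)‖ ≤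
      2 * (ps.map fun p => p * (1 - p)).sum * |s| ^ 3 := by
  have h1 : aeval (Complex.exp (s * Complex.I)) (bernoulliPoly ps) *
      Complex.exp (-(s * ps.sum : ℝ) * Complex.I) =
      (ps.map fun p : ℝ => ((1 - p : ℝ) + (p : ℝ) * Complex.exp (s * Complex.I)) *
        Complex.exp (-(s * p : ℝ) * Complex.I)).prod := by
    clear hps
    induction ps using Multiset.induction_on with
    | empty => simp [bernoulliPoly]
    | cons p ps ih =>
      rw [Multiset.map_cons, Multiset.prod_cons, ← ih, bernoulliPoly_cons, Multiset.sum_cons]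
      have : -((s * (p + ps.sum) : ℝ) : ℂ) * Complex.I =
        -((s * p : ℝ) : ℂ) * Complex.I + -((s * ps.sum : ℝ) : ℂ) * Complex.I := by
        push_cast; ring
      rw [this, Complex.exp_add]
      simp only [map_mul, map_add, aeval_C, aeval_X, Complex.coe_algebraMap]
      ring
  have h2 : ((Real.exp (-(ps.map fun p => p * (1 - p)).sum * s ^ 2 / 2) : ℝ) : ℂ) =
      (ps.map fun p : ℝ => ((Real.exp (-(p * (1 - p)) * s ^ 2 / 2) : ℝ) : ℂ)).prod := by
    clear hps h1
    induction ps using Multiset.induction_on with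
    | empty => simp
    | cons p ps ih =>
      rw [Multiset.map_cons, Multiset.map_cons, Multiset.prod_cons, ← ih, Multiset.sum_cons,
        ← Complex.ofReal_mul, ← Real.exp_add]
      congr 2
      ring
  rw [h1, h2]
  refine (norm_prod_sub_prod_le_sum_norm_sub ps
    (fun p hp => norm_bernoulli_charFun_le (hps p hp).1 (hps p hp).2 s) ?_).trans ?_
  · intro p hp
    have hv := mul_nonneg (hps p hp).1 (sub_nonneg.2 (hps p hp).2)
    rw [Complex.norm_real, Real.norm_of_nonneg (Real.exp_nonneg _), Real.exp_le_one_iff]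
    nlinarith [sq_nonneg s]
  · refine (Multiset.sum_map_le_sum_map _ _ fun p hp =>
      norm_bernoulli_charFun_sub_exp_le (hps p hp).1 (hps p hp).2 hs).trans_eq ?_
    rw [Multiset.sum_map_mul_right, Multiset.sum_map_mul_left]

theorem coeff_bernoulliPoly_nonneg {ps : Multiset ℝ} (hps : ∀ p ∈ ps, 0 ≤ p ∧ p ≤ 1) (k : ℕ) :
    0 ≤ (bernoulliPoly ps).coeff k := by
  induction ps using Multiset.induction_on generalizing k with
  | empty => simp only [bernoulliPoly, Multiset.map_zero, Multiset.prod_zero, coeff_one]; positivity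
  | cons p ps ih =>
    have ih := ih fun q hq => hps q (Multiset.mem_cons_of_mem hq)
    obtain ⟨h0, h1⟩ := hps p (Multiset.mem_cons_self p ps)
    have hq : 0 ≤ 1 - p := by linarith
    rw [bernoulliPoly_cons, add_mul, mul_assoc, coeff_add, coeff_C_mul, coeff_C_mul]
    have := ih k
    cases k with
    | zero => simp only [coeff_X_mul_zero]; positivity
    | succ k =>
      have := ih k
      rw [coeff_X_mul]; positivity

theorem sum_coeff_mul_natCast (S : ℝ[X]) :
    ∑ k ∈ Finset.range (S.natDegree + 1), (k : ℝ) * S.coeff k = (derivative S).eval 1 := by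
  rw [← S.sum_over_range (f := fun k b => (k : ℝ) * b) (by simp)]
  rw [derivative_eval]
  simp [mul_comm]

theorem sum_coeff_mul_natCast_sq (S : ℝ[X]) :
    ∑ k ∈ Finset.range (S.natDegree + 1), (k : ℝ) ^ 2 * S.coeff k =
      (derivative (derivative S)).eval 1 + (derivative S).eval 1 := by
  rw [← S.sum_over_range (f := fun k b => (k : ℝ) ^ 2 * b) (by simp)]
  induction S using Polynomial.induction_on' with
  | add S T hS hT =>
    rw [sum_add_index _ _ _ (by simp) (by intros; ring), hS, hT]
    simp only [derivative_add, eval_add]; ring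
  | monomial k b =>
    rw [sum_monomial_index _ _ (by simp)]
    cases k with
    | zero => simp
    | succ k => simp [derivative_monomial]; ring

end BernoulliCLT

section FinitelySupported

open MeasureTheory Polynomial

theorem finsum_int_eq_sum_range {f : ℤ → ℝ} {N : ℕ} (hneg : ∀ k < 0, f k = 0)
    (hN : ∀ k : ℕ, N < k → f k = 0) : ∑ᶠ k, f k = ∑ j ∈ Finset.range (N + 1), f j := by
  rw [finsum_eq_sum_of_support_subset (s := (Finset.range (N + 1)).map Nat.castEmbedding)]
  · simp
  · intro k hk
    rw [Function.mem_support] at hk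
    have hk0 : 0 ≤ k := by by_contra h; exact hk (hneg k (by omega))
    lift k to ℕ using hk0
    have : ¬ N < k := fun h => hk (hN k h)
    simp
    omega

/-- The coefficients of a polynomial as a sequence indexed by `ℤ`. -/
noncomputable def coeffSeq (S : ℝ[X]) (k : ℤ) : ℝ := if 0 ≤ k then S.coeff k.toNat else 0

theorem coeffSeq_natCast (S : ℝ[X]) (k : ℕ) : coeffSeq S k = S.coeff k := by simp [coeffSeq]

theorem coeffSeq_of_neg (S : ℝ[X]) {k : ℤ} (hk : k < 0) : coeffSeq S k = 0 := by
  simp [coeffSeq, hk]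

theorem finsum_coeffSeq (S : ℝ[X]) {f : ℤ → ℝ → ℝ} (hf : ∀ k, f k 0 = 0) :
    ∑ᶠ k, f k (coeffSeq S k) = ∑ j ∈ Finset.range (S.natDegree + 1), f j (S.coeff j) := by
  rw [finsum_int_eq_sum_range (N := S.natDegree)]
  · simp only [coeffSeq_natCast]
  · intro k hk; rw [coeffSeq_of_neg S hk, hf]
  · intro k hk; rw [coeffSeq_natCast, coeff_eq_zero_of_natDegree_lt hk, hf]

theorem seqTotal_coeffSeq (S : ℝ[X]) : seqTotal (coeffSeq S) = S.eval 1 := by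
  rw [seqTotal, finsum_coeffSeq S (f := fun _ x => x) (fun _ => rfl), eval_eq_sum_range]
  simp

variable {T : ℝ} {ps : Multiset ℝ}

theorem seqPMF_coeffSeq (hT : T ≠ 0) (k : ℤ) :
    seqPMF (coeffSeq (C T * bernoulliPoly ps)) k = coeffSeq (bernoulliPoly ps) k := by
  rw [seqPMF, seqTotal_coeffSeq, eval_mul, eval_C, eval_one_bernoulliPoly, coeffSeq, coeffSeq]
  split_ifs
  · rw [coeff_C_mul]; field_simp
  · simp

theorem seqMean_coeffSeq (hT : T ≠ 0) :
    seqMean (coeffSeq (C T * bernoulliPoly ps)) = ps.sum := by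
  simp only [seqMean, seqPMF_coeffSeq hT]
  rw [finsum_coeffSeq _ (f := fun k x => (k : ℝ) * x) (by simp)]
  simp only [Int.cast_natCast]
  rw [sum_coeff_mul_natCast, eval_one_derivative_bernoulliPoly]

theorem sum_coeff_bernoulliPoly (ps : Multiset ℝ) :
    ∑ j ∈ Finset.range ((bernoulliPoly ps).natDegree + 1), (bernoulliPoly ps).coeff j = 1 := by
  rw [← eval_one_bernoulliPoly ps, eval_eq_sum_range]
  simp

theorem sum_map_mul_one_sub (ps : Multiset ℝ) :
    (ps.map fun p => p * (1 - p)).sum = ps.sum - (ps.map fun p => p ^ 2).sum := by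
  nth_rewrite 2 [← Multiset.map_id' ps]
  rw [← Multiset.sum_map_sub]
  congr 1
  refine Multiset.map_congr rfl fun p _ => ?_
  ring

theorem seqStdDev_coeffSeq (hT : T ≠ 0) :
    seqStdDev (coeffSeq (C T * bernoulliPoly ps)) = √(ps.map fun p => p * (1 - p)).sum := by
  simp only [seqStdDev, seqPMF_coeffSeq hT, seqMean_coeffSeq hT]
  rw [finsum_coeffSeq _ (f := fun k x => ((k : ℝ) - ps.sum) ^ 2 * x) (by simp)]
  congr 1
  have h0 := sum_coeff_bernoulliPoly ps
  have h1 := sum_coeff_mul_natCast (bernoulliPoly ps)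
  have h2 := sum_coeff_mul_natCast_sq (bernoulliPoly ps)
  rw [eval_one_derivative_bernoulliPoly] at h1 h2
  rw [eval_one_derivative_derivative_bernoulliPoly] at h2
  set B := bernoulliPoly ps
  have h3 : ∑ j ∈ Finset.range (B.natDegree + 1), (((j : ℤ) : ℝ) - ps.sum) ^ 2 * B.coeff j =
      ∑ j ∈ Finset.range (B.natDegree + 1), (j : ℝ) ^ 2 * B.coeff j -
      2 * ps.sum * ∑ j ∈ Finset.range (B.natDegree + 1), (j : ℝ) * B.coeff j +
      ps.sum ^ 2 * ∑ j ∈ Finset.range (B.natDegree + 1), B.coeff j := by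
    rw [Finset.mul_sum, Finset.mul_sum, ← Finset.sum_sub_distrib, ← Finset.sum_add_distrib]
    refine Finset.sum_congr rfl fun j _ => ?_
    push_cast
    ring
  rw [h3, h0, h1, h2, sum_map_mul_one_sub]
  ring

/-- The law of the standardised random variable with generating function `bernoulliPoly ps`. -/
noncomputable def standardizedLaw (ps : Multiset ℝ) : Measure ℝ :=
  ∑ j ∈ Finset.range ((bernoulliPoly ps).natDegree + 1),
    ENNReal.ofReal ((bernoulliPoly ps).coeff j) •
      Measure.dirac (((j : ℝ) - ps.sum) / √(ps.map fun p => p * (1 - p)).sum)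

theorem isProbabilityMeasure_standardizedLaw (hps : ∀ p ∈ ps, 0 ≤ p ∧ p ≤ 1) :
    IsProbabilityMeasure (standardizedLaw ps) := by
  constructor
  simp only [standardizedLaw, Measure.coe_finsetSum, Finset.sum_apply, Measure.smul_apply,
    measure_univ, smul_eq_mul, mul_one]
  rw [← ENNReal.ofReal_sum_of_nonneg fun j _ => coeff_bernoulliPoly_nonneg hps j,
    sum_coeff_bernoulliPoly, ENNReal.ofReal_one]

theorem standardizedLaw_real_Iic (hT : T ≠ 0) (hps : ∀ p ∈ ps, 0 ≤ p ∧ p ≤ 1) (x : ℝ) :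
    (standardizedLaw ps).real (Set.Iic x) =
      seqNormalizedCDF (coeffSeq (C T * bernoulliPoly ps)) x := by
  classical
  rw [seqNormalizedCDF, finsum_mem_def, seqMean_coeffSeq hT, seqStdDev_coeffSeq hT]
  have h1 : (fun k => Set.indicator {k : ℤ | ((k : ℝ) - ps.sum) /
      √(ps.map fun p => p * (1 - p)).sum ≤ x} (seqPMF (coeffSeq (C T * bernoulliPoly ps))) k) =
      fun k : ℤ => if ((k : ℝ) - ps.sum) / √(ps.map fun p => p * (1 - p)).sum ≤ x then
        coeffSeq (bernoulliPoly ps) k else 0 := by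
    ext k
    rw [Set.indicator_apply, seqPMF_coeffSeq hT]
    rfl
  rw [h1, finsum_coeffSeq _ (f := fun k y => if ((k : ℝ) - ps.sum) /
      √(ps.map fun p => p * (1 - p)).sum ≤ x then y else 0) (by simp)]
  simp only [standardizedLaw, Measure.real, Measure.coe_finsetSum, Finset.sum_apply,
    Measure.smul_apply, smul_eq_mul]
  rw [ENNReal.toReal_sum]
  · refine Finset.sum_congr rfl fun j _ => ?_
    rw [ENNReal.toReal_mul, ENNReal.toReal_ofReal (coeff_bernoulliPoly_nonneg hps j),
      Measure.dirac_apply' _ measurableSet_Iic, Set.indicator_apply]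
    simp only [Set.mem_Iic, Int.cast_natCast]
    split_ifs <;> simp
  · intro j _
    exact ENNReal.mul_ne_top ENNReal.ofReal_ne_top (measure_ne_top _ _)

theorem charFun_standardizedLaw (hps : ∀ p ∈ ps, 0 ≤ p ∧ p ≤ 1) (t : ℝ) :
    charFun (standardizedLaw ps) t =
      aeval (Complex.exp ((t / √(ps.map fun p => p * (1 - p)).sum : ℝ) * Complex.I))
        (bernoulliPoly ps) *
      Complex.exp (-(t / √(ps.map fun p => p * (1 - p)).sum * ps.sum : ℝ) * Complex.I) := by
  rw [charFun_apply_real, standardizedLaw, integral_finsetSum_measure, aeval_eq_sum_range,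
    Finset.sum_mul]
  · refine Finset.sum_congr rfl fun j _ => ?_
    rw [integral_smul_measure, integral_dirac,
      ENNReal.toReal_ofReal (coeff_bernoulliPoly_nonneg hps j), ← Complex.exp_nat_mul,
      smul_mul_assoc, ← Complex.exp_add]
    congr 2
    push_cast
    ring
  · intro j _
    refine Integrable.smul_measure ?_ ENNReal.ofReal_ne_top
    exact integrable_dirac (by simp)

end FinitelySupported

section Limit

open MeasureTheory ProbabilityTheory Polynomial Filter Topology

theorem gaussianReal_real_Iic (x : ℝ) : (gaussianReal 0 1).real (Set.Iic x) = stdNormalCDF x := by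
  have := nullSingletonClass_gaussianReal (μ := 0) (v := 1) one_ne_zero
  rw [Measure.real, ← measure_congr (Iio_ae_eq_Iic (μ := gaussianReal 0 1) (a := x)),
    gaussianReal_apply_eq_integral 0 one_ne_zero, ENNReal.toReal_ofReal]
  · rw [stdNormalCDF]
    refine integral_congr_ae (ae_of_all _ fun t => ?_)
    simp [gaussianPDFReal, div_eq_mul_inv, mul_comm]
  · exact integral_nonneg fun t => gaussianPDFReal_nonneg 0 1 t

/-- A central limit theorem for sums of independent Bernoulli variables. -/
theorem asymptoticallyNormal_coeffSeq_bernoulliPoly {T : ℕ → ℝ} (hT : ∀ n, T n ≠ 0)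
    {ps : ℕ → Multiset ℝ} (hps : ∀ n, ∀ p ∈ ps n, 0 ≤ p ∧ p ≤ 1)
    (hvar : Tendsto (fun n => ((ps n).map fun p => p * (1 - p)).sum) atTop atTop) :
    AsymptoticallyNormal fun n => coeffSeq (C (T n) * bernoulliPoly (ps n)) := by
  intro x
  let μ : ℕ → ProbabilityMeasure ℝ := fun n =>
    ⟨standardizedLaw (ps n), isProbabilityMeasure_standardizedLaw (hps n)⟩
  let μ₀ : ProbabilityMeasure ℝ := ⟨gaussianReal 0 1, inferInstance⟩
  have hsqrt : Tendsto (fun n => √((ps n).map fun p => p * (1 - p)).sum) atTop atTop :=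
    Real.tendsto_sqrt_atTop.comp hvar
  have hμ : Tendsto μ atTop (𝓝 μ₀) := by
    refine ProbabilityMeasure.tendsto_iff_tendsto_charFun.2 fun t => ?_
    change Tendsto (fun n => charFun (standardizedLaw (ps n)) t) atTop
      (𝓝 (charFun (gaussianReal 0 1) t))
    rw [tendsto_iff_norm_sub_tendsto_zero]
    have hbound : Tendsto (fun n => 2 * |t| ^ 3 / √((ps n).map fun p => p * (1 - p)).sum)
        atTop (𝓝 0) := tendsto_const_nhds.div_atTop hsqrt
    refine squeeze_zero' (Eventually.of_forall fun n => norm_nonneg _) ?_ hbound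
    filter_upwards [hsqrt.eventually_ge_atTop (max 1 |t|)] with n hn
    rw [charFun_standardizedLaw (hps n)]
    set V := ((ps n).map fun p => p * (1 - p)).sum with hV
    have hσ : 0 < √V := by linarith [le_max_left 1 |t|]
    have hVσ : V = √V ^ 2 := (Real.sq_sqrt (Real.sqrt_pos.1 hσ).le).symm
    have habs : |t / √V| = |t| / √V := by rw [abs_div, abs_of_pos hσ]
    have h := norm_charFun_bernoulliPoly_sub_exp_le (hps n) (s := t / √V) (by
      rw [habs, div_le_one hσ]; exact (le_max_right _ _).trans hn)
    have hg : charFun (gaussianReal 0 1) t =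
        (Real.exp (-V * (t / √V) ^ 2 / 2) : ℝ) := by
      have : -V * (t / √V) ^ 2 / 2 = - t ^ 2 / 2 := by
        nth_rewrite 1 [hVσ]; field_simp
      rw [charFun_gaussianReal, this]
      push_cast
      simp
      ring_nf
    rw [hg]
    refine h.trans_eq ?_
    rw [habs, ← hV]
    nth_rewrite 1 [hVσ]
    field_simp
  have hlim := ProbabilityMeasure.tendsto_measure_of_null_frontier_of_tendsto' hμ
    (E := Set.Iic x) (by
      have := nullSingletonClass_gaussianReal (μ := 0) (v := 1) one_ne_zero
      simp [μ₀])
  have hlim' := (ENNReal.tendsto_toReal (measure_ne_top _ _)).comp hlim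
  have h0 : ((μ₀ : Measure ℝ) (Set.Iic x)).toReal = stdNormalCDF x := gaussianReal_real_Iic x
  rw [h0] at hlim'
  refine hlim'.congr fun n => ?_
  exact standardizedLaw_real_Iic (hT n) (hps n) x

end Limit

section ForestWeights

open Filter

/-- The weight `q ^ c * (q - 1) ^ m / q!` of the number of colours in Dobinski's formula
for forests. -/
noncomputable def forestWeight (c m q : ℕ) : ℝ := (q : ℝ) ^ c * ((q : ℝ) - 1) ^ m / q.factorial

theorem forestWeight_nonneg {c : ℕ} (hc : c ≠ 0) (m q : ℕ) : 0 ≤ forestWeight c m q := by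
  rcases Nat.eq_zero_or_pos q with rfl | hq
  · simp [forestWeight, hc]
  · have : (0 : ℝ) ≤ (q : ℝ) - 1 := by
      have : (1 : ℝ) ≤ q := by exact_mod_cast hq
      linarith
    unfold forestWeight
    positivity

theorem forestWeight_pos (c m : ℕ) {q : ℕ} (hq : 2 ≤ q) : 0 < forestWeight c m q := by
  have h1 : (2 : ℝ) ≤ q := by exact_mod_cast hq
  have : (0 : ℝ) < (q : ℝ) - 1 := by linarith
  unfold forestWeight
  positivity

/-- Near-geometric behaviour of the weights far beyond the square root of the number of
vertices. -/
theorem forestWeight_mul_ge {c m r : ℕ} {δ : ℝ} (hr : 1 ≤ r) (hδ : 0 ≤ δ) (hδ1 : δ ≤ 1)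
    (h1 : ((c + m : ℕ) : ℝ) ≤ δ * (r : ℝ) ^ 2) (h2 : 1 ≤ δ * r) :
    (1 - 2 * δ) * forestWeight c m (r + 1) ^ 2 ≤
      forestWeight c m (r + 2) * forestWeight c m r := by
  have hr1 : (1 : ℝ) ≤ r := by exact_mod_cast hr
  have hr0 : (0 : ℝ) < r := by linarith
  have hr2 : (1 : ℝ) ≤ (r : ℝ) ^ 2 := by nlinarith
  set x : ℝ := (r : ℝ) with hx
  set ε : ℝ := 1 / x ^ 2 with hε
  have hε0 : 0 ≤ ε := by positivity
  have hε1 : ε ≤ 1 := by rw [hε, div_le_one (by positivity)]; exact hr2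
  have hεx : ε * x ^ 2 = 1 := by rw [hε]; field_simp
  have hpow : 1 - δ ≤ (1 - ε) ^ (c + m) := by
    have := one_add_mul_le_pow (a := -ε) (by linarith) (c + m)
    have h3 : ((c + m : ℕ) : ℝ) * ε ≤ δ := by
      rw [hε, mul_one_div, div_le_iff₀ (by positivity)]; exact h1
    have h4 : (1 - ε) ^ (c + m) = (1 + -ε) ^ (c + m) := by ring
    rw [h4]
    linarith
  have ha : ((1 - ε) * (x + 1) ^ 2) ^ c ≤ ((x + 2) * x) ^ c := by
    refine pow_le_pow_left₀ (by have := sub_nonneg.2 hε1; positivity) ?_ c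
    nlinarith
  have hb : ((1 - ε) * x ^ 2) ^ m ≤ ((x + 1) * (x - 1)) ^ m := by
    refine pow_le_pow_left₀ (by have := sub_nonneg.2 hε1; positivity) ?_ m
    nlinarith
  have hf1 : ((r + 1).factorial : ℝ) = (x + 1) * r.factorial := by
    rw [Nat.factorial_succ]; push_cast; rfl
  have hf2 : ((r + 2).factorial : ℝ) = (x + 2) * ((x + 1) * r.factorial) := by
    rw [Nat.factorial_succ, Nat.cast_mul, hf1]; push_cast; ring
  have hF : (0 : ℝ) < r.factorial := by positivity
  have hl : forestWeight c m (r + 1) ^ 2 =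
      ((x + 1) ^ 2) ^ c * (x ^ 2) ^ m / ((x + 1) ^ 2 * (r.factorial : ℝ) ^ 2) := by
    rw [forestWeight, hf1]
    push_cast
    rw [← hx, add_sub_cancel_right, div_pow, mul_pow, mul_pow, ← pow_mul, ← pow_mul, ← pow_mul,
      ← pow_mul, mul_comm c, mul_comm m]
  have hrr : forestWeight c m (r + 2) * forestWeight c m r =
      ((x + 2) * x) ^ c * ((x + 1) * (x - 1)) ^ m /
        ((x + 2) * (x + 1) * (r.factorial : ℝ) ^ 2) := by
    rw [forestWeight, forestWeight, hf2]
    push_cast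
    rw [← hx, div_mul_div_comm, mul_pow, mul_pow]
    ring
  rw [hl, hrr]
  have hab : (1 - δ) * (((x + 1) ^ 2) ^ c * (x ^ 2) ^ m) ≤
      ((x + 2) * x) ^ c * ((x + 1) * (x - 1)) ^ m := by
    calc (1 - δ) * (((x + 1) ^ 2) ^ c * (x ^ 2) ^ m)
        ≤ (1 - ε) ^ (c + m) * (((x + 1) ^ 2) ^ c * (x ^ 2) ^ m) := by gcongr
      _ = ((1 - ε) * (x + 1) ^ 2) ^ c * ((1 - ε) * x ^ 2) ^ m := by
        rw [mul_pow, mul_pow, pow_add]; ring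
      _ ≤ _ := by
        refine mul_le_mul ha hb ?_ ?_
        · have := sub_nonneg.2 hε1; positivity
        · positivity
  set A := ((x + 1) ^ 2) ^ c * (x ^ 2) ^ m with hA
  have hA0 : 0 ≤ A := by positivity
  have hfin : (1 - 2 * δ) * (x + 2) ≤ (1 - δ) * (x + 1) := by nlinarith
  rw [mul_div_assoc', div_le_div_iff₀ (by positivity) (by positivity)]
  calc (1 - 2 * δ) * A * ((x + 2) * (x + 1) * (r.factorial : ℝ) ^ 2)
      = ((1 - 2 * δ) * (x + 2)) * (A * (x + 1) * (r.factorial : ℝ) ^ 2) := by ring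
    _ ≤ ((1 - δ) * (x + 1)) * (A * (x + 1) * (r.factorial : ℝ) ^ 2) := by gcongr
    _ = ((1 - δ) * A) * ((x + 1) ^ 2 * (r.factorial : ℝ) ^ 2) := by ring
    _ ≤ _ := by gcongr

/-- A positive sequence that is nearly log-convex and initially nondecreasing decays slowly. -/
theorem pow_sq_mul_le_of_nearly_logConvex {u : ℕ → ℝ} {ρ : ℝ} (hu : ∀ j, 0 < u j) (hρ : 0 ≤ ρ)
    (hρ1 : ρ ≤ 1) (h01 : u 0 ≤ u 1) (h : ∀ j, ρ * u (j + 1) ^ 2 ≤ u (j + 2) * u j) (j : ℕ) :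
    ρ ^ (j ^ 2) * u 1 ≤ u (j + 1) := by
  have hstep (j : ℕ) : ρ ^ j * u j ≤ u (j + 1) := by
    induction j with
    | zero => simpa using h01
    | succ j ih =>
      have h1 : ρ ^ (j + 1) * u (j + 1) * u j ≤ u (j + 2) * u j := by
        calc ρ ^ (j + 1) * u (j + 1) * u j = ρ * u (j + 1) * (ρ ^ j * u j) := by ring
          _ ≤ ρ * u (j + 1) * u (j + 1) := by
            have := (hu (j + 1)).le
            gcongr
          _ = ρ * u (j + 1) ^ 2 := by ring
          _ ≤ _ := h j
      exact le_of_mul_le_mul_right h1 (hu j)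
  induction j with
  | zero => simp
  | succ j ih =>
    calc ρ ^ ((j + 1) ^ 2) * u 1 ≤ ρ ^ (j + 1 + j ^ 2) * u 1 := by
          refine mul_le_mul_of_nonneg_right ?_ (hu 1).le
          exact pow_le_pow_of_le_one hρ hρ1 (by nlinarith)
      _ = ρ ^ (j + 1) * (ρ ^ (j ^ 2) * u 1) := by rw [pow_add]; ring
      _ ≤ ρ ^ (j + 1) * u (j + 1) := by gcongr
      _ ≤ _ := hstep (j + 1)

theorem le_mul_log_of_forestWeight_succ_le {c m q : ℕ} (hq : 2 ≤ q)
    (h : forestWeight c m (q + 1) ≤ forestWeight c m q) :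
    ((c + m : ℕ) : ℝ) ≤ ((q : ℝ) + 1) * Real.log ((q : ℝ) + 1) := by
  have hx2 : (2 : ℝ) ≤ q := by exact_mod_cast hq
  rw [forestWeight, forestWeight, Nat.factorial_succ] at h
  push_cast at h
  rw [add_sub_cancel_right] at h
  set x : ℝ := (q : ℝ) with hx
  have hF : (0 : ℝ) < q.factorial := by positivity
  have h1 : (x + 1) ^ c * x ^ m ≤ (x + 1) * (x ^ c * (x - 1) ^ m) := by
    rw [div_le_div_iff₀ (by positivity) hF] at h
    refine le_of_mul_le_mul_right ?_ hF
    linarith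
  have h2 : (x + 1) ^ (c + m) ≤ (x + 1) * x ^ (c + m) := by
    have h3 : ((x - 1) * (x + 1)) ^ m ≤ (x ^ 2) ^ m :=
      pow_le_pow_left₀ (mul_nonneg (by linarith) (by linarith)) (by nlinarith) m
    have h4 : (x + 1) ^ (c + m) * x ^ m ≤ (x + 1) * x ^ (c + m) * x ^ m := by
      calc (x + 1) ^ (c + m) * x ^ m = ((x + 1) ^ c * x ^ m) * (x + 1) ^ m := by
            rw [pow_add]; ring
        _ ≤ ((x + 1) * (x ^ c * (x - 1) ^ m)) * (x + 1) ^ m := by gcongr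
        _ = (x + 1) * x ^ c * ((x - 1) * (x + 1)) ^ m := by rw [mul_pow]; ring
        _ ≤ (x + 1) * x ^ c * (x ^ 2) ^ m := by gcongr
        _ = _ := by rw [pow_add]; ring
    exact le_of_mul_le_mul_right h4 (by positivity)
  have h5 := Real.log_le_log (by positivity) h2
  rw [Real.log_mul (by positivity) (by positivity), Real.log_pow, Real.log_pow] at h5
  have h6 := Real.one_sub_inv_le_log_of_pos (x := (x + 1) / x) (by positivity)
  rw [Real.log_div (by positivity) (by positivity), inv_div] at h6
  have h7 : 1 - x / (x + 1) = 1 / (x + 1) := by field_simp; ring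
  rw [h7, div_le_iff₀ (by positivity)] at h6
  set n : ℝ := ((c + m : ℕ) : ℝ)
  have hn : 0 ≤ n := Nat.cast_nonneg _
  nlinarith

theorem exists_forall_le_mul_sq {δ : ℝ} (hδ : 0 < δ) :
    ∃ N : ℝ, ∀ n : ℝ, N ≤ n → ∀ x : ℝ, 2 ≤ x → n ≤ (x + 1) * Real.log (x + 1) →
      n ≤ δ * (x - 1) ^ 2 := by
  have h := Real.isLittleO_log_id_atTop.bound (show (0 : ℝ) < δ / 4 by positivity)
  obtain ⟨Q, hQ⟩ := eventually_atTop.1 h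
  refine ⟨(max Q 4) ^ 2 + 1, fun n hn x hx hnx => ?_⟩
  have hlog : Real.log (x + 1) ≤ x + 1 :=
    (Real.log_le_sub_one_of_pos (by linarith)).trans (by linarith)
  have hxQ : max Q 4 ≤ x + 1 := by
    by_contra hlt
    have : (x + 1) * Real.log (x + 1) ≤ (x + 1) * (x + 1) := by gcongr
    nlinarith
  have hq := hQ (x + 1) ((le_max_left _ _).trans hxQ)
  have h4 : (4 : ℝ) ≤ x + 1 := (le_max_right _ _).trans hxQ
  rw [id, Real.norm_eq_abs, Real.norm_eq_abs, abs_of_nonneg (by linarith : 0 ≤ x + 1)] at hq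
  have hq := (le_abs_self _).trans hq
  have h5 : (x + 1) * Real.log (x + 1) ≤ (x + 1) * (δ / 4 * (x + 1)) := by gcongr
  have h6 : (x + 1) ^ 2 ≤ 4 * (x - 1) ^ 2 := by nlinarith
  nlinarith

theorem exists_forall_le_of_summable {w : ℕ → ℝ} (hw : Summable w) {q₀ : ℕ} (h : 0 < w q₀) :
    ∃ q, ∀ j, w j ≤ w q := by
  obtain ⟨N, hN⟩ := eventually_atTop.1 (hw.tendsto_atTop_zero.eventually_lt_const h)
  obtain ⟨q, -, hq⟩ := (Finset.range (N + q₀ + 1)).exists_max_image w ⟨0, by simp⟩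
  refine ⟨q, fun j => ?_⟩
  by_cases hj : j < N + q₀ + 1
  · exact hq j (Finset.mem_range.2 hj)
  · exact (hN j (by omega)).le.trans (hq q₀ (Finset.mem_range.2 (by omega)))

/-- No single weight carries a positive proportion of the mass in the limit. -/
theorem exists_forall_forestWeight_le (K : ℕ) :
    ∃ N : ℕ, ∀ c m : ℕ, N ≤ c + m → c ≠ 0 → ∀ W : ℝ, HasSum (forestWeight c m) W →
      ∀ q, K * forestWeight c m q ≤ 2 * W := by
  set δ : ℝ := 1 / (4 * ((K : ℝ) ^ 2 + 1)) with hδ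
  have hδ0 : 0 < δ := by positivity
  have hδK : 4 * (δ * ((K : ℝ) ^ 2 + 1)) = 1 := by rw [hδ]; field_simp
  have hδ1 : 4 * δ ≤ 1 := by nlinarith [sq_nonneg (K : ℝ)]
  obtain ⟨N, hN⟩ := exists_forall_le_mul_sq hδ0
  refine ⟨⌈max N (1 / δ)⌉₊ + 3, fun c m hcm hc W hW q => ?_⟩
  have hnN : max N (1 / δ) ≤ ((c + m : ℕ) : ℝ) := by
    refine (Nat.le_ceil _).trans ?_
    exact_mod_cast (by omega : ⌈max N (1 / δ)⌉₊ ≤ c + m)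
  obtain ⟨M, hM⟩ := exists_forall_le_of_summable hW.summable (forestWeight_pos c m (q := 2) le_rfl)
  have h3 : 1 < forestWeight c m 3 := by
    have h8 : (2 : ℝ) ^ 3 ≤ 2 ^ (c + m) := pow_le_pow_right₀ (by norm_num) (by omega)
    have : (2 : ℝ) ^ (c + m) ≤ 3 ^ c * 2 ^ m := by
      rw [pow_add]
      gcongr
      norm_num
    rw [forestWeight]
    norm_num [Nat.factorial] at h8 ⊢
    rw [lt_div_iff₀ (by norm_num)]
    linarith
  have hM2 : 2 ≤ M := by
    by_contra hlt
    have hM3 := hM 3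
    have : M = 0 ∨ M = 1 := by omega
    rcases this with rfl | rfl
    · simp [forestWeight, hc] at hM3 h3
      linarith
    · have : forestWeight c m 1 ≤ 1 := by
        rcases Nat.eq_zero_or_pos m with rfl | hm
        · simp [forestWeight]
        · simp [forestWeight, hm.ne']
      linarith
  have hx2 : (2 : ℝ) ≤ M := by exact_mod_cast hM2
  have hMn := hN _ ((le_max_left _ _).trans hnN) M hx2
    (le_mul_log_of_forestWeight_succ_le hM2 (hM (M + 1)))
  have hδn : 1 ≤ δ * ((c + m : ℕ) : ℝ) := by
    have := (le_max_right N (1 / δ)).trans hnN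
    rw [div_le_iff₀ hδ0] at this
    linarith
  have hδM : 1 ≤ δ * ((M : ℝ) - 1) := by
    have : 1 ≤ (δ * ((M : ℝ) - 1)) ^ 2 := by nlinarith
    have h0 : 0 ≤ δ * ((M : ℝ) - 1) := mul_nonneg hδ0.le (by linarith)
    nlinarith
  obtain ⟨r, rfl⟩ : ∃ r, M = r + 1 := ⟨M - 1, by omega⟩
  push_cast at hMn hδM
  rw [add_sub_cancel_right] at hMn hδM
  have hr4 : (4 : ℝ) ≤ r := by nlinarith [Nat.cast_nonneg (α := ℝ) r]
  have hr4' : 4 ≤ r := by exact_mod_cast hr4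
  have hρ : 0 ≤ 1 - 2 * δ := by linarith
  have hseq := pow_sq_mul_le_of_nearly_logConvex (u := fun j => forestWeight c m (r + j))
    (ρ := 1 - 2 * δ) (fun j => forestWeight_pos c m (by omega)) hρ (by linarith) (hM r)
    (fun j => by
      have hrj : (r : ℝ) ≤ ((r + j : ℕ) : ℝ) := by exact_mod_cast Nat.le_add_right r j
      refine forestWeight_mul_ge (r := r + j) (by omega) hδ0.le (by linarith) ?_ ?_
      · rw [Nat.cast_add]
        refine hMn.trans ?_
        gcongr
      · refine hδM.trans ?_
        gcongr)
  have hhalf (j : ℕ) (hj : j < K) :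
      forestWeight c m (r + 1) / 2 ≤ forestWeight c m (r + 1 + j) := by
    have h1 := hseq j
    have h2 : (1 : ℝ) / 2 ≤ (1 - 2 * δ) ^ (j ^ 2) := by
      have h3 := one_add_mul_le_pow (a := -(2 * δ)) (by linarith) (j ^ 2)
      have h4 : ((j ^ 2 : ℕ) : ℝ) ≤ (K : ℝ) ^ 2 := by
        push_cast
        gcongr
      have h5 : (1 - 2 * δ) ^ (j ^ 2) = (1 + -(2 * δ)) ^ (j ^ 2) := by ring
      rw [h5]
      nlinarith
    have h6 := (forestWeight_pos c m (q := r + 1) (by omega)).le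
    have h7 : r + 1 + j = r + (j + 1) := by omega
    rw [h7]
    refine le_trans ?_ h1
    rw [div_eq_inv_mul]
    refine mul_le_mul_of_nonneg_right ?_ h6
    linarith
  have hsum : K * (forestWeight c m (r + 1) / 2) ≤ W := by
    calc (K : ℝ) * (forestWeight c m (r + 1) / 2)
        = ∑ j ∈ Finset.range K, forestWeight c m (r + 1) / 2 := by simp
      _ ≤ ∑ j ∈ Finset.range K, forestWeight c m (r + 1 + j) :=
        Finset.sum_le_sum fun j hj => hhalf j (Finset.mem_range.1 hj)
      _ = ∑ q ∈ (Finset.range K).map (addLeftEmbedding (r + 1)), forestWeight c m q := by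
        simp
      _ ≤ W := sum_le_hasSum _ (fun q _ => forestWeight_nonneg hc m q) hW
  have := mul_le_mul_of_nonneg_left (hM q) (Nat.cast_nonneg (α := ℝ) K)
  linarith

/-- If no weight is large, then the second moment about any point is large. -/
theorem sq_mul_le_of_forall_le {w : ℕ → ℝ} (hw : ∀ q, 0 ≤ w q) {W V ν : ℝ} {R : ℕ}
    (hW : HasSum w W) (hV : HasSum (fun q : ℕ => ((q : ℝ) - ν) ^ 2 * w q) V)
    (h : ∀ q, (8 * R : ℕ) * w q ≤ 2 * W) : (R : ℝ) ^ 2 * W ≤ 2 * V := by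
  set l := ⌈ν - R⌉₊ with hl
  set I := Finset.Ico l (l + 2 * R) with hI
  have hsumI : 2 * ∑ q ∈ I, w q ≤ W := by
    rcases Nat.eq_zero_or_pos R with rfl | hR
    · simpa [hI] using hW.nonneg hw
    · have hR' : (0 : ℝ) < R := by exact_mod_cast hR
      have h1 : ∑ q ∈ I, w q ≤ ∑ q ∈ I, W / (4 * R) := by
        refine Finset.sum_le_sum fun q _ => ?_
        have := h q
        push_cast at this
        rw [le_div_iff₀ (by positivity)]
        linarith
      rw [Finset.sum_const, hI, Nat.card_Ico, Nat.add_sub_cancel_left, nsmul_eq_mul] at h1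
      push_cast at h1
      have h2 : 2 * (R : ℝ) * (W / (4 * R)) = W / 2 := by field_simp; ring
      rw [h2] at h1
      linarith
  have h2 : HasSum (fun q => if q ∈ I then w q else 0) (∑ q ∈ I, w q) := by
    have h3 : ∑ q ∈ I, w q = ∑ q ∈ I, if q ∈ I then w q else 0 :=
      Finset.sum_congr rfl fun q hq => by rw [if_pos hq]
    rw [h3]
    exact hasSum_sum_of_ne_finset_zero fun q hq => by rw [if_neg hq]
  have h4 := hasSum_le (fun q => ?_) ((hW.sub h2).mul_left ((R : ℝ) ^ 2)) hV
  · nlinarith [sq_nonneg (R : ℝ)]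
  · by_cases hq : q ∈ I
    · rw [if_pos hq, sub_self, mul_zero]
      exact mul_nonneg (sq_nonneg _) (hw q)
    · rw [if_neg hq, sub_zero]
      refine mul_le_mul_of_nonneg_right ?_ (hw q)
      rw [hI, Finset.mem_Ico, not_and_or, not_le, not_lt] at hq
      rcases hq with hq | hq
      · have : (q : ℝ) < ν - R := Nat.lt_ceil.1 hq
        nlinarith [Nat.cast_nonneg (α := ℝ) R]
      · have h5 : ((l + 2 * R : ℕ) : ℝ) ≤ q := by exact_mod_cast hq
        have h6 : ν - R ≤ l := Nat.le_ceil _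
        push_cast at h5
        nlinarith [Nat.cast_nonneg (α := ℝ) R]

end ForestWeights

section Forest

open Polynomial Filter

/-- The polynomial whose coefficients are the graph Stirling numbers of a forest with chromatic
polynomial `X ^ c * (X - 1) ^ m`. -/
noncomputable def forestPoly (c m : ℕ) : ℝ[X] := (touchardStep 1)^[m] ((touchardStep 0)^[c] 1)

theorem fallingEval_forestPoly (q c m : ℕ) :
    fallingEval q (forestPoly c m) = (q : ℝ) ^ c * ((q : ℝ) - 1) ^ m := by
  have h1 : fallingEval q 1 = 1 := by
    have := fallingEval_monomial q 0 1
    simpa using this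
  rw [forestPoly, fallingEval_iterate_touchardStep, fallingEval_iterate_touchardStep, h1]
  ring

theorem hasSum_forestWeight (c m : ℕ) :
    HasSum (forestWeight c m) (Real.exp 1 * (forestPoly c m).eval 1) := by
  have h := hasSum_fallingEval_div_factorial (forestPoly c m)
  simp only [fallingEval_forestPoly] at h
  exact h

theorem eval_one_forestPoly_pos {c : ℕ} (hc : c ≠ 0) (m : ℕ) : 0 < (forestPoly c m).eval 1 := by
  have h := (hasSum_forestWeight c m).summable.tsum_pos (fun q => forestWeight_nonneg hc m q) 2
    (forestWeight_pos c m le_rfl)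
  rw [(hasSum_forestWeight c m).tsum_eq] at h
  exact pos_of_mul_pos_right h (Real.exp_pos 1).le

/-- The second central moment appearing in Dobinski's formula is one more than the variance of the
sum of independent Bernoulli variables. -/
theorem eval_one_touchardStep_touchardStep (T : ℝ) (ps : Multiset ℝ) :
    (touchardStep (ps.sum + 1) (touchardStep (ps.sum + 1) (C T * bernoulliPoly ps))).eval 1 =
      T * (1 + (ps.map fun p => p * (1 - p)).sum) := by
  rw [sum_map_mul_one_sub]
  simp only [touchardStep, derivative_sub, derivative_mul, derivative_add, derivative_X,
    derivative_C, eval_sub, eval_mul, eval_add, eval_X, eval_C, eval_one_bernoulliPoly,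
    eval_one_derivative_bernoulliPoly, eval_one_derivative_derivative_bernoulliPoly, eval_one,
    eval_zero, derivative_zero]
  ring

theorem exists_forall_sq_le_of_forestPoly_eq (R : ℕ) :
    ∃ N, ∀ c m, N ≤ c + m → c ≠ 0 → ∀ ps,
      forestPoly c m = C ((forestPoly c m).eval 1) * bernoulliPoly ps →
        (R : ℝ) ^ 2 ≤ 2 * (1 + (ps.map fun p => p * (1 - p)).sum) := by
  obtain ⟨N, hN⟩ := exists_forall_forestWeight_le (8 * R)
  refine ⟨N, fun c m hcm hc ps hps => ?_⟩
  have hT := eval_one_forestPoly_pos hc m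
  have hV := hasSum_fallingEval_div_factorial
    ((touchardStep (ps.sum + 1))^[2] (forestPoly c m))
  have heval : ((touchardStep (ps.sum + 1))^[2] (forestPoly c m)).eval 1 =
      (forestPoly c m).eval 1 * (1 + (ps.map fun p => p * (1 - p)).sum) := by
    rw [← eval_one_touchardStep_touchardStep, ← hps]
    rfl
  simp only [fallingEval_iterate_touchardStep, fallingEval_forestPoly, mul_div_assoc] at hV
  rw [heval] at hV
  have h := sq_mul_le_of_forall_le (fun q => forestWeight_nonneg hc m q) (hasSum_forestWeight c m)
    (by simpa only [forestWeight, mul_div_assoc] using hV)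
    (hN c m hcm hc _ (hasSum_forestWeight c m))
  have hW : 0 < Real.exp 1 * (forestPoly c m).eval 1 := mul_pos (Real.exp_pos 1) hT
  refine le_of_mul_le_mul_right (h.trans_eq ?_) hW
  ring

theorem coeff_forestPoly {V : Type*} [Fintype V] (G : SimpleGraph V) {c m : ℕ}
    (hcm : m ≠ 0 → c ≠ 0)
    (hG : ∀ q, Nat.card (G.Coloring (Fin q)) = q ^ c * (q - 1) ^ m) (k : ℕ) :
    (forestPoly c m).coeff k = graphStirling G k := by
  classical
  set P : ℝ[X] := ∑ k ∈ Finset.range (Fintype.card (Finset V) + 1),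
    monomial k (graphStirling G k : ℝ) with hP
  have heq : P - forestPoly c m = 0 := by
    refine eq_zero_of_fallingEval_eq_zero fun q => ?_
    have h1 : fallingEval q P = ((q ^ c * (q - 1) ^ m : ℕ) : ℝ) := by
      rw [← hG q, card_coloring_eq_sum_graphStirling, hP, map_sum]
      push_cast
      exact Finset.sum_congr rfl fun k _ => by rw [fallingEval_monomial, mul_comm]
    rw [map_sub, h1, fallingEval_forestPoly, sub_eq_zero]
    rcases Nat.eq_zero_or_pos q with rfl | hq
    · rcases eq_or_ne m 0 with rfl | hm
      · simp
      · simp [hcm hm]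
    · push_cast [Nat.cast_sub hq]
      ring
  rw [← sub_eq_zero.1 heq, hP, finsetSum_coeff]
  simp only [coeff_monomial, Finset.sum_ite_eq', Finset.mem_range]
  split_ifs with hk
  · rfl
  · rw [graphStirling_eq_zero G (by omega), Nat.cast_zero]

end Forest

/-- If `G n` is an acyclic graph (a forest) on `n` vertices for each `n`, then the graph
Stirling sequence of `G n` is asymptotically normal. -/
theorem forest_graphStirling_asymptotically_normal
    (V : ℕ → Type) [∀ n, Fintype (V n)] (G : ∀ n, SimpleGraph (V n))
    (hcard : ∀ n, Fintype.card (V n) = n) (hacyclic : ∀ n, (G n).IsAcyclic) :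
    AsymptoticallyNormal (fun n k => if 0 ≤ k then (graphStirling (G n) k.toNat : ℝ) else 0) := by
  choose c m hn hcm hG using fun n => (hacyclic n).exists_card_coloring n (hcard n)
  have hroots (n : ℕ) : HasNonposRoots (forestPoly (c n) (m n)) :=
    hasNonposRoots_iterate_touchardStep (hcm n)
  choose ps hps hS using fun n => (hroots n).exists_eq_bernoulliPoly
  have hT (n : ℕ) : (forestPoly (c n) (m n)).eval 1 ≠ 0 := fun h => by
    have h1 := hS n
    rw [h, Polynomial.C_0, zero_mul] at h1
    exact (hroots n).ne_zero h1
  have hvar : Filter.Tendsto (fun n => ((ps n).map fun p => p * (1 - p)).sum)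
      Filter.atTop Filter.atTop := by
    refine Filter.tendsto_atTop.2 fun b => ?_
    obtain ⟨R, hR⟩ := exists_nat_ge (2 * (1 + |b|))
    obtain ⟨N, hN⟩ := exists_forall_sq_le_of_forestPoly_eq R
    filter_upwards [Filter.eventually_ge_atTop (max N 1)] with n hnN
    have hc : c n ≠ 0 := fun h => by
      have := hn n
      have := hcm n
      omega
    have h1 := hN (c n) (m n) (by have := hn n; omega) hc (ps n) (hS n)
    nlinarith [le_abs_self b, abs_nonneg b]
  have h := asymptoticallyNormal_coeffSeq_bernoulliPoly hT hps hvar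
  simp only [← hS] at h
  convert h using 4 with n k
  rw [coeffSeq, coeff_forestPoly (G n) (hcm n) (hG n)]
end

section
/- Let x denote the operator of multiplication by X and D the derivative operator on the ring ℝ[X] of real polynomials in one variable. If w is any finite word in the symbols x and D containing m x's and n D's with m ≥ n, then there exists a unique finitely supported sequence of coefficients (S_w(k))_{k ∈ ℤ} such that, as operators on ℝ[X], w = x^{m−n} Σ_{k ∈ ℤ} S_w(k) x^k D^k. -/
/-- A word in the symbols `x` (here `true`) and `D` (here `false`) is a Dyck word if it has
equally many `x`'s and `D`'s and every prefix has at least as many `x`'s as `D`'s. -/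
def IsDyck (w : List Bool) : Prop :=
  w.count true = w.count false ∧
    ∀ p : ℕ, (w.take p).count false ≤ (w.take p).count true

/-- The operator of multiplication by `X` on `ℝ[X]`. -/
noncomputable def xOp : Polynomial ℝ →ₗ[ℝ] Polynomial ℝ := LinearMap.mulLeft ℝ Polynomial.X

/-- The derivative operator on `ℝ[X]`. -/
noncomputable def dOp : Polynomial ℝ →ₗ[ℝ] Polynomial ℝ := Polynomial.derivative

/-- The operator on `ℝ[X]` represented by a word in `x` and `D`, read left to right (so the
leftmost symbol is the outermost operator). -/
noncomputable def wordOp : List Bool → (Polynomial ℝ →ₗ[ℝ] Polynomial ℝ)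
  | [] => LinearMap.id
  | b :: w => (if b then xOp else dOp) ∘ₗ wordOp w

/-- The operator `x^k D^k` on `ℝ[X]` (interpreted as `0` for negative `k`). -/
noncomputable def xkDk (k : ℤ) : Polynomial ℝ →ₗ[ℝ] Polynomial ℝ :=
  if 0 ≤ k then (xOp ^ k.toNat) ∘ₗ (dOp ^ k.toNat) else 0

/-- `S : ℤ → ℝ` is the (finitely supported) sequence of normal order coefficients of the
word `w`, i.e. `w = Σ_k S k • x^k D^k` as operators on `ℝ[X]`, with `S k = 0` for `k < 0`. -/
def IsNormalOrder (w : List Bool) (S : ℤ → ℝ) : Prop :=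
  (Function.support S).Finite ∧ (∀ k : ℤ, k < 0 → S k = 0) ∧
    wordOp w = ∑ᶠ k : ℤ, S k • xkDk k

theorem dOp_mul_xOp : dOp * xOp = xOp * dOp + 1 := by
  refine LinearMap.ext fun p => ?_
  simp [dOp, xOp, Polynomial.derivative_mul, add_comm]

theorem dOp_mul_xOp_pow (i : ℕ) :
    dOp * xOp ^ i = xOp ^ i * dOp + (i : ℝ) • xOp ^ (i - 1) := by
  induction i with
  | zero => simp
  | succ i ih =>
    have hx : (i : ℝ) • (xOp ^ (i - 1) * xOp) = (i : ℝ) • xOp ^ i := by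
      cases i with
      | zero => simp
      | succ i => simp [pow_succ]
    rw [pow_succ, ← mul_assoc, ih, add_mul, mul_assoc, dOp_mul_xOp, smul_mul_assoc, hx]
    simp only [mul_add, mul_one, ← mul_assoc, Nat.add_sub_cancel]
    push_cast
    module

theorem wordOp_mem_span (w : List Bool) :
    wordOp w ∈ Submodule.span ℝ {f | ∃ i j : ℕ,
      i + w.count false = j + w.count true ∧ f = xOp ^ i * dOp ^ j} := by
  induction w with
  | nil => exact Submodule.subset_span ⟨0, 0, by simp, rfl⟩
  | cons b w ih =>
    have key : wordOp (b :: w) = (if b then xOp else dOp) * wordOp w := rfl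
    rw [key]
    generalize wordOp w = f at ih ⊢
    induction ih using Submodule.span_induction with
    | zero => simp
    | add f g _ _ hf hg => rw [mul_add]; exact add_mem hf hg
    | smul a f _ hf => rw [mul_smul_comm]; exact Submodule.smul_mem _ a hf
    | mem f hf =>
      obtain ⟨i, j, hij, rfl⟩ := hf
      cases b with
      | true =>
        refine Submodule.subset_span ⟨i + 1, j, by simp; omega, ?_⟩
        rw [if_pos rfl, pow_succ', mul_assoc]
      | false =>
        rw [if_neg (by simp), ← mul_assoc, dOp_mul_xOp_pow, add_mul, mul_assoc, ← pow_succ',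
          smul_mul_assoc]
        refine add_mem (Submodule.subset_span ⟨i, j + 1, by simp; omega, rfl⟩) ?_
        cases i with
        | zero => simp
        | succ i =>
          exact Submodule.smul_mem _ _ (Submodule.subset_span ⟨i, j, by simp; omega, rfl⟩)

theorem xkDk_natCast (k : ℕ) : xkDk k = xOp ^ k * dOp ^ k := by
  simp [xkDk, Module.End.mul_eq_comp]

theorem xOp_pow_apply (k : ℕ) (p : Polynomial ℝ) : (xOp ^ k) p = Polynomial.X ^ k * p := by
  induction k with
  | zero => simp
  | succ k ih => rw [pow_succ', Module.End.mul_apply, ih]; simp [xOp, pow_succ', mul_assoc]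

theorem xkDk_natCast_X_pow (k j : ℕ) :
    xkDk k (Polynomial.X ^ j) = (j.descFactorial k : ℝ) • (Polynomial.X ^ j) := by
  have hd : (dOp ^ k) (Polynomial.X ^ j) = Polynomial.derivative^[k] (Polynomial.X ^ j) := by
    rw [Module.End.pow_apply]; rfl
  rw [xkDk_natCast, Module.End.mul_apply, xOp_pow_apply, hd,
    Polynomial.iterate_derivative_X_pow_eq_smul]
  rcases le_or_gt k j with hkj | hkj
  · rw [mul_smul_comm, ← pow_add, Nat.add_sub_cancel' hkj, Nat.cast_smul_eq_nsmul]
  · simp [Nat.descFactorial_of_lt hkj]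

theorem linearIndependent_xkDk : LinearIndependent ℝ fun k : ℕ => xkDk k := by
  rw [linearIndependent_iff]
  intro l hl
  ext k
  induction k using Nat.strong_induction_on with
  | _ k ih =>
    have h := congrArg (fun f => (f (Polynomial.X ^ k)).coeff k) hl
    simp only [Finsupp.linearCombination_apply, Finsupp.sum, LinearMap.sum_apply,
      LinearMap.smul_apply, xkDk_natCast_X_pow, Polynomial.finsetSum_coeff,
      Polynomial.coeff_smul, Polynomial.coeff_X_pow_self, LinearMap.zero_apply,
      Polynomial.coeff_zero, smul_eq_mul, mul_one] at h
    rw [Finset.sum_eq_single k] at h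
    · simpa [Nat.descFactorial_self, Nat.factorial_ne_zero] using h
    · intro i _ hik
      rcases lt_or_gt_of_ne hik with hi | hi
      · simp [ih i hi]
      · simp [Nat.descFactorial_of_lt hi]
    · intro hk
      simp [Finsupp.notMem_support_iff.mp hk]

theorem finsum_smul_xkDk {S : ℤ → ℝ} (hneg : ∀ k : ℤ, k < 0 → S k = 0) {c : ℕ →₀ ℝ}
    (hc : ∀ k : ℕ, S k = c k) :
    ∑ᶠ k : ℤ, S k • xkDk k = Finsupp.linearCombination ℝ (fun k : ℕ => xkDk k) c := by
  rw [finsum_eq_sum_of_support_subset (s := c.support.map Nat.castEmbedding), Finset.sum_map,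
    Finsupp.linearCombination_apply, Finsupp.sum]
  · simp [hc]
  · intro k hk
    have hS : S k ≠ 0 := fun h0 => hk (by simp [h0])
    lift k to ℕ using not_lt.mp fun h => hS (hneg k h)
    rw [hc] at hS
    simpa using hS

theorem exists_finsupp_eq_natCast {S : ℤ → ℝ} (hfin : (Function.support S).Finite) :
    ∃ c : ℕ →₀ ℝ, ∀ k : ℕ, S k = c k :=
  ⟨Finsupp.ofSupportFinite (fun k : ℕ => S k)
    (hfin.preimage Nat.cast_injective.injOn), fun _ => rfl⟩

theorem exists_natCast_eq_finsupp (c : ℕ →₀ ℝ) :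
    ∃ S : ℤ → ℝ, (Function.support S).Finite ∧ (∀ k : ℤ, k < 0 → S k = 0) ∧
      ∀ k : ℕ, S k = c k := by
  refine ⟨fun k => if 0 ≤ k then c k.toNat else 0, ?_, fun k hk => if_neg hk.not_ge, by simp⟩
  refine (c.support.map Nat.castEmbedding).finite_toSet.subset fun k hk => ?_
  by_cases h0 : 0 ≤ k
  · lift k to ℕ using h0
    simpa using hk
  · simp [h0] at hk

/-- Every word `w` in `x` and `D` with `m` `x`'s and `n` `D`'s, `m ≥ n`, has a unique normal
order: there is a unique finitely supported sequence `(S k)_{k ∈ ℤ}` (vanishing for `k < 0`)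
with `w = x^(m-n) Σ_k S k x^k D^k` as operators on `ℝ[X]`. -/
theorem normal_order_exists_unique (w : List Bool) (h : w.count false ≤ w.count true) :
    ∃! S : ℤ → ℝ, (Function.support S).Finite ∧ (∀ k : ℤ, k < 0 → S k = 0) ∧
      wordOp w = (xOp ^ (w.count true - w.count false)) ∘ₗ ∑ᶠ k : ℤ, S k • xkDk k := by
  set a := w.count true - w.count false with ha
  have hex : ∃ c : ℕ →₀ ℝ, wordOp w =
      (xOp ^ a) ∘ₗ Finsupp.linearCombination ℝ (fun k : ℕ => xkDk k) c := by
    have hle : Submodule.span ℝ {f | ∃ i j : ℕ,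
        i + w.count false = j + w.count true ∧ f = xOp ^ i * dOp ^ j} ≤
        (LinearMap.range (Finsupp.linearCombination ℝ (fun k : ℕ => xkDk k))).map
          (LinearMap.mulLeft ℝ (xOp ^ a)) := by
      refine Submodule.span_le.mpr ?_
      rintro _ ⟨i, j, hij, rfl⟩
      refine ⟨xkDk j, ⟨Finsupp.single j 1, by simp⟩, ?_⟩
      rw [LinearMap.mulLeft_apply, xkDk_natCast, ← mul_assoc, ← pow_add]
      congr 2
      omega
    obtain ⟨_, ⟨c, rfl⟩, hc⟩ := hle (wordOp_mem_span w)
    exact ⟨c, hc.symm⟩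
  have hinj : Function.Injective (xOp ^ a) := fun p q hpq => by
    rw [xOp_pow_apply, xOp_pow_apply] at hpq
    exact mul_left_cancel₀ (pow_ne_zero a Polynomial.X_ne_zero) hpq
  obtain ⟨c, hwc⟩ := hex
  obtain ⟨S, hfin, hneg, hSc⟩ := exists_natCast_eq_finsupp c
  refine ⟨S, ⟨hfin, hneg, by rw [finsum_smul_xkDk hneg hSc, hwc]⟩, ?_⟩
  rintro T ⟨hTfin, hTneg, hT⟩
  obtain ⟨d, hTd⟩ := exists_finsupp_eq_natCast hTfin
  rw [finsum_smul_xkDk hTneg hTd, hwc] at hT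
  have hcd : c = d := linearIndependent_xkDk
    (LinearMap.ext fun p => hinj (LinearMap.congr_fun hT p))
  funext k
  rcases lt_or_ge k 0 with hk | hk
  · rw [hTneg k hk, hneg k hk]
  · lift k to ℕ using hk
    rw [hTd, hSc, hcd]
end

section
/- If G is a quasi-threshold graph on n vertices, then there exists a Dyck word w with n x's and n D's such that G_w is isomorphic to G. -/
/-- The graph obtained from `G` by adding a dominating vertex (a new vertex adjacent to all
the vertices of `G`). -/
def addDom {V : Type} (G : SimpleGraph V) : SimpleGraph (Option V) :=
  SimpleGraph.fromRel (fun a b =>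
    (∃ u v : V, a = some u ∧ b = some v ∧ G.Adj u v) ∨ a = none)

/-- The disjoint union of two graphs. -/
def disjUnion {V W : Type} (G : SimpleGraph V) (H : SimpleGraph W) : SimpleGraph (V ⊕ W) :=
  SimpleGraph.fromRel (fun a b =>
    (∃ u v : V, a = Sum.inl u ∧ b = Sum.inl v ∧ G.Adj u v) ∨
    (∃ u v : W, a = Sum.inr u ∧ b = Sum.inr v ∧ H.Adj u v))

/-- Quasi-threshold graphs: the smallest class of graphs (closed under isomorphism) containing
`K_1` and closed under adding a dominating vertex and under disjoint union. -/
inductive IsQuasiThreshold : {V : Type} → SimpleGraph V → Prop where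
  | single : IsQuasiThreshold (⊥ : SimpleGraph PUnit)
  | addDominating {V : Type} {G : SimpleGraph V} :
      IsQuasiThreshold G → IsQuasiThreshold (addDom G)
  | union {V W : Type} {G : SimpleGraph V} {H : SimpleGraph W} :
      IsQuasiThreshold G → IsQuasiThreshold H → IsQuasiThreshold (disjUnion G H)
  | iso {V W : Type} {G : SimpleGraph V} {H : SimpleGraph W} :
      IsQuasiThreshold G → G ≃g H → IsQuasiThreshold H
/-- `WordGraph w V G` asserts that `G` (on vertex set `V`) is the quasi-threshold graph `G_w`
associated with the Dyck word `w`: `G_{xD} = K_1`; `G_{x w' D} = G_{w'}` plus a dominating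
vertex; and the graph of a concatenation of non-empty Dyck words is the disjoint union of
their graphs. -/
inductive WordGraph : List Bool → (V : Type) → SimpleGraph V → Prop where
  | k1 : WordGraph [true, false] PUnit ⊥
  | dom {w : List Bool} {V : Type} {G : SimpleGraph V} :
      WordGraph w V G → WordGraph ([true] ++ w ++ [false]) (Option V) (addDom G)
  | union {w₁ w₂ : List Bool} {V₁ V₂ : Type} {G₁ : SimpleGraph V₁} {G₂ : SimpleGraph V₂} :
      w₁ ≠ [] → w₂ ≠ [] → WordGraph w₁ V₁ G₁ → WordGraph w₂ V₂ G₂ →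
      WordGraph (w₁ ++ w₂) (V₁ ⊕ V₂) (disjUnion G₁ G₂)

theorem addDom_adj_some {V : Type} {G : SimpleGraph V} {u v : V} :
    (addDom G).Adj (some u) (some v) ↔ G.Adj u v := by
  simp only [addDom, SimpleGraph.fromRel_adj]
  have := @SimpleGraph.Adj.ne V G u v
  have := G.adj_comm u v
  simp
  tauto

theorem addDom_adj_none_some {V : Type} {G : SimpleGraph V} {v : V} :
    (addDom G).Adj none (some v) := by
  simp [addDom]

theorem disjUnion_eq_sum {V W : Type} (G : SimpleGraph V) (H : SimpleGraph W) :
    disjUnion G H = G.sum H := by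
  ext (u | u) (v | v)
  · have := @SimpleGraph.Adj.ne V G u v
    have := G.adj_comm u v
    simp [disjUnion]
    tauto
  · simp [disjUnion]
  · simp [disjUnion]
  · have := @SimpleGraph.Adj.ne W H u v
    have := H.adj_comm u v
    simp [disjUnion]
    tauto

/-- Adding a dominating vertex respects graph isomorphism. -/
def addDomIso {V W : Type} {G : SimpleGraph V} {H : SimpleGraph W} (e : G ≃g H) :
    addDom G ≃g addDom H where
  toEquiv := e.toEquiv.optionCongr
  map_rel_iff' := by
    rintro (_ | u) (_ | v)
    · simp
    · simp [addDom_adj_none_some]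
    · simp [SimpleGraph.adj_comm _ (some _) none, addDom_adj_none_some]
    · simpa [addDom_adj_some] using e.map_adj_iff

/-- Disjoint unions respect graph isomorphism. -/
def disjUnionIso {V V' W W' : Type} {G : SimpleGraph V} {G' : SimpleGraph V'}
    {H : SimpleGraph W} {H' : SimpleGraph W'} (e : G ≃g G') (f : H ≃g H') :
    disjUnion G H ≃g disjUnion G' H' where
  toEquiv := Equiv.sumCongr e.toEquiv f.toEquiv
  map_rel_iff' := by
    rintro (u | u) (v | v)
    · simpa [disjUnion_eq_sum] using e.map_adj_iff
    · simp [disjUnion_eq_sum]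
    · simp [disjUnion_eq_sum]
    · simpa [disjUnion_eq_sum] using f.map_adj_iff

theorem IsDyck.append {w₁ w₂ : List Bool} (h₁ : IsDyck w₁) (h₂ : IsDyck w₂) :
    IsDyck (w₁ ++ w₂) := by
  refine ⟨by simp [h₁.1, h₂.1], fun p => ?_⟩
  simpa only [List.take_append, List.count_append] using
    Nat.add_le_add (h₁.2 p) (h₂.2 (p - w₁.length))

theorem IsDyck.nest {w : List Bool} (h : IsDyck w) : IsDyck ([true] ++ w ++ [false]) := by
  refine ⟨by simp [h.1], fun p => ?_⟩
  rcases p with _ | p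
  · simp
  · have hw := h.2 p
    have hf : (([false] : List Bool).take (p - w.length)).count false ≤ 1 :=
      List.count_le_length.trans (by simp)
    simp only [List.cons_append, List.nil_append, List.take_succ_cons, List.take_append,
      List.count_cons, List.count_append]
    simp
    omega

theorem WordGraph.ne_nil {w : List Bool} {V : Type} {G : SimpleGraph V}
    (h : WordGraph w V G) : w ≠ [] := by
  induction h <;> simp_all

theorem WordGraph.isDyck {w : List Bool} {V : Type} {G : SimpleGraph V}
    (h : WordGraph w V G) : IsDyck w := by
  induction h with
  | k1 => exact IsDyck.nest (w := []) ⟨rfl, by simp⟩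
  | dom _ ih => exact ih.nest
  | union _ _ _ _ ih₁ ih₂ => exact ih₁.append ih₂

theorem WordGraph.finite {w : List Bool} {V : Type} {G : SimpleGraph V}
    (h : WordGraph w V G) : Finite V := by
  induction h <;> infer_instance

theorem WordGraph.count_true {w : List Bool} {V : Type} {G : SimpleGraph V}
    (h : WordGraph w V G) : w.count true = Nat.card V := by
  induction h with
  | k1 => simp
  | dom h ih =>
    have := h.finite
    simp [ih, Finite.card_option]
  | union _ _ h₁ h₂ ih₁ ih₂ =>
    have := h₁.finite
    have := h₂.finite
    simp [ih₁, ih₂, Nat.card_sum]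

theorem IsQuasiThreshold.exists_wordGraph {V : Type} {G : SimpleGraph V}
    (hG : IsQuasiThreshold G) :
    ∃ (w : List Bool) (W : Type) (H : SimpleGraph W), WordGraph w W H ∧ Nonempty (H ≃g G) := by
  induction hG with
  | single => exact ⟨_, _, _, .k1, ⟨.refl⟩⟩
  | addDominating _ ih =>
    obtain ⟨w, W, H, h, ⟨e⟩⟩ := ih
    exact ⟨_, _, _, h.dom, ⟨addDomIso e⟩⟩
  | union _ _ ih₁ ih₂ =>
    obtain ⟨w₁, W₁, H₁, h₁, ⟨e₁⟩⟩ := ih₁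
    obtain ⟨w₂, W₂, H₂, h₂, ⟨e₂⟩⟩ := ih₂
    exact ⟨_, _, _, .union h₁.ne_nil h₂.ne_nil h₁ h₂, ⟨disjUnionIso e₁ e₂⟩⟩
  | iso _ f ih =>
    obtain ⟨w, W, H, h, ⟨e⟩⟩ := ih
    exact ⟨w, W, H, h, ⟨e.trans f⟩⟩

/-- Every quasi-threshold graph `G` on `n` vertices arises (up to isomorphism) as `G_w` for
some Dyck word `w` with `n` `x`'s and `n` `D`'s. -/
theorem exists_dyck_word_of_quasiThreshold
    (V : Type) [Fintype V] (G : SimpleGraph V) (hG : IsQuasiThreshold G) (n : ℕ)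
    (hn : Fintype.card V = n) :
    ∃ (w : List Bool) (W : Type) (H : SimpleGraph W), IsDyck w ∧ w.count true = n ∧
      w.count false = n ∧ WordGraph w W H ∧ Nonempty (H ≃g G) := by
  obtain ⟨w, W, H, h, ⟨e⟩⟩ := hG.exists_wordGraph
  have hc : w.count true = n := by
    rw [h.count_true, Nat.card_congr e.toEquiv, Nat.card_eq_fintype_card, hn]
  exact ⟨w, W, H, h.isDyck, hc, h.isDyck.1 ▸ hc, h, ⟨e⟩⟩
end

section
/- For every Dyck word w with n x's and every integer k, the normal order coefficient S_w(k) equals the graph Stirling number {H_w brace k}. -/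
/-- `xsBefore w i` is the number of `x`'s (`true`s) occurring before the `i`-th `D` (`false`)
in the word `w` (1-indexed); if `w` has fewer than `i` `D`'s it is the total number of `x`'s. -/
def xsBefore : List Bool → ℕ → ℕ
  | [], _ => 0
  | _ :: _, 0 => 0
  | true :: w, i + 1 => xsBefore w (i + 1) + 1
  | false :: w, i + 1 => if i = 0 then 0 else xsBefore w i

/-- The Ferrers board `B_w`: the set of (labels of) unit squares lying above the Dyck path of
`w` and inside the box `[0,n] × [0,n]`, where the unit square with top-right corner `(i,j)` is
labelled `(i,j)`.  The square `(i,j)` lies above the path exactly when the `i`-th `D` of `w`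
occurs before the `j`-th `x`, i.e. when `xsBefore w i < j`. -/
def ferrersBoard (w : List Bool) : Finset (ℕ × ℕ) :=
  ((Finset.Icc 1 (w.count true)) ×ˢ (Finset.Icc 1 (w.count true))).filter
    (fun p => xsBefore w p.1 < p.2)

/-- `rookCount B k` is the number of placements of `k` non-attacking rooks on the board `B`:
`k`-element subsets of `B` with no two elements sharing a first coordinate and no two sharing
a second coordinate. -/
noncomputable def rookCount (B : Finset (ℕ × ℕ)) (k : ℕ) : ℕ :=
  Nat.card {s : Finset (ℕ × ℕ) // s ⊆ B ∧ s.card = k ∧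
    ∀ p ∈ s, ∀ q ∈ s, p ≠ q → p.1 ≠ q.1 ∧ p.2 ≠ q.2}

/-- The clique-union graph `H_w` on vertex set `{1, …, n}` (encoded as `Fin n`, vertex `i`
having label `i+1`): labels `i < j` are adjacent iff the unit square labelled `(i,j)` lies
below the Dyck path of `w` and completely above the line `x = y`, i.e. iff the `j`-th `x`
occurs before the `i`-th `D`, i.e. iff `j ≤ xsBefore w i`. -/
def cliqueUnionGraph (w : List Bool) : SimpleGraph (Fin (w.count true)) :=
  SimpleGraph.fromRel (fun i j => (i : ℕ) < (j : ℕ) ∧ (j : ℕ) + 1 ≤ xsBefore w ((i : ℕ) + 1))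

/-- The bipartite graph `Γ_w` with partition classes `X = {x_1, …, x_n}` (the `inl` vertices)
and `Y = {y_1, …, y_n}` (the `inr` vertices), with an edge from `x_i` to `y_j` iff
`(i,j) ∈ B_w`. -/
def bipGraph (w : List Bool) : SimpleGraph (Fin (w.count true) ⊕ Fin (w.count true)) :=
  SimpleGraph.fromRel (fun a b => ∃ i j : Fin (w.count true),
    a = Sum.inl i ∧ b = Sum.inr j ∧ xsBefore w ((i : ℕ) + 1) < (j : ℕ) + 1)

/-- `matchCount G k` is the number of matchings of size `k` in `G`: sets of `k` edges of `G`,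
pairwise sharing no endvertex. -/
noncomputable def matchCount {V : Type*} (G : SimpleGraph V) (k : ℕ) : ℕ :=
  Nat.card {s : Finset (Sym2 V) // s.card = k ∧ (∀ e ∈ s, e ∈ G.edgeSet) ∧
    ∀ e ∈ s, ∀ f ∈ s, e ≠ f → ∀ v : V, v ∈ e → v ∉ f}

/-- The matching number of `G`: the size of a largest matching. -/
noncomputable def matchNumber {V : Type*} (G : SimpleGraph V) : ℕ :=
  sSup {k : ℕ | 0 < matchCount G k}

open Classical in
/-- The set of non-empty fibres of `f`. -/
noncomputable def fiberPartition {V α : Type*} [Fintype V] (f : V → α) : Finset (Finset V) :=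
  Finset.univ.image fun v => Finset.univ.filter fun u => f u = f v

open Classical in
/-- The set of partitions of the vertex set of `G` into non-empty independent sets. -/
noncomputable def stablePartitions {V : Type*} [Fintype V] (G : SimpleGraph V) :
    Finset (Finset (Finset V)) :=
  Finset.univ.filter fun P => (∀ p ∈ P, p.Nonempty) ∧
    (∀ v : V, ∃! p, p ∈ P ∧ v ∈ p) ∧ ∀ p ∈ P, ∀ u ∈ p, ∀ v ∈ p, ¬ G.Adj u v

open Classical in
/-- The set of proper colourings of `G` with `m` colours. -/
noncomputable def properColorings {V : Type*} [Fintype V] (G : SimpleGraph V) (m : ℕ) :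
    Finset (V → Fin m) :=
  Finset.univ.filter fun f => ∀ u v, G.Adj u v → f u ≠ f v

lemma fiberPartition_mem_stablePartitions {V : Type*} [Fintype V] {G : SimpleGraph V} {m : ℕ}
    {f : V → Fin m} (hf : f ∈ properColorings G m) :
    fiberPartition f ∈ stablePartitions G := by
  classical
  simp only [properColorings, Finset.mem_filter, Finset.mem_univ, true_and] at hf
  simp only [stablePartitions, fiberPartition, Finset.mem_filter, Finset.mem_univ, true_and,
    Finset.mem_image, forall_exists_index, forall_apply_eq_imp_iff]
  refine ⟨fun v => ⟨v, by simp⟩, fun v => ?_, fun a u hu v hv huv => ?_⟩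
  · refine ⟨Finset.univ.filter fun u => f u = f v, ⟨⟨v, by ext; simp⟩, by simp⟩, ?_⟩
    rintro _ ⟨⟨a, rfl⟩, hv⟩
    simp only [Finset.mem_filter, Finset.mem_univ, true_and] at hv
    ext
    simp [hv]
  · exact hf u v huv (hu.trans hv.symm)

open Classical in
lemma card_filter_fiberPartition_eq {V : Type*} [Fintype V] {G : SimpleGraph V} (m : ℕ)
    {P : Finset (Finset V)} (hP : P ∈ stablePartitions G) :
    ((properColorings G m).filter fun f => fiberPartition f = P).card
      = m.descFactorial P.card := by
  simp only [stablePartitions, Finset.mem_filter, Finset.mem_univ, true_and] at hP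
  obtain ⟨hne, hcov, hind⟩ := hP
  have hπ : ∃ π : V → P, ∀ v, ∀ p : P, v ∈ p.1 ↔ π v = p := by
    choose g hg hu using hcov
    refine ⟨fun v => ⟨g v, (hg v).1⟩, fun v p => ⟨fun h => ?_, ?_⟩⟩
    · exact Subtype.ext (hu v p.1 ⟨p.2, h⟩).symm
    · rintro rfl
      exact (hg v).2
  obtain ⟨π, hπ⟩ := hπ
  have hsurj : Function.Surjective π := fun p => by
    obtain ⟨v, hv⟩ := hne p.1 p.2
    exact ⟨v, (hπ v p).1 hv⟩
  have hcard : (Finset.univ : Finset (P ↪ Fin m)).card = m.descFactorial P.card := by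
    rw [Finset.card_univ, Fintype.card_embedding_eq]
    simp
  rw [← hcard]
  symm
  refine Finset.card_bij (fun e _ v => e (π v)) ?_ ?_ ?_
  · intro e _
    simp only [properColorings, Finset.mem_filter, Finset.mem_univ, true_and]
    refine ⟨fun u v huv h => ?_, ?_⟩
    · have h' := e.injective h
      exact hind (π u).1 (π u).2 u ((hπ u _).2 rfl) v ((hπ v _).2 h'.symm) huv
    · have hcl : ∀ v, (Finset.univ.filter fun u => e (π u) = e (π v)) = (π v).1 := by
        intro v
        ext u
        simp [hπ u (π v), e.injective.eq_iff]
      ext p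
      simp only [fiberPartition, hcl, Finset.mem_image, Finset.mem_univ, true_and]
      constructor
      · rintro ⟨v, rfl⟩
        exact (π v).2
      · intro hp
        obtain ⟨v, hv⟩ := hsurj ⟨p, hp⟩
        exact ⟨v, by rw [hv]⟩
  · intro e₁ _ e₂ _ h
    ext p
    obtain ⟨v, rfl⟩ := hsurj p
    exact congrArg Fin.val (congrFun h v)
  · intro f hf
    obtain ⟨-, rfl⟩ := Finset.mem_filter.1 hf
    have hcl : ∀ p : fiberPartition f, ∃ v, p.1 = Finset.univ.filter fun u => f u = f v := by
      rintro ⟨p, hp⟩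
      obtain ⟨v, -, rfl⟩ := Finset.mem_image.1 hp
      exact ⟨v, by ext; simp⟩
    choose r hr using hcl
    have hfr : ∀ v, f (r (π v)) = f v := by
      intro v
      have h := (hπ v (π v)).2 rfl
      rw [hr] at h
      exact (Finset.mem_filter.1 h).2.symm
    refine ⟨⟨fun p => f (r p), fun p q h => ?_⟩, Finset.mem_univ _, funext hfr⟩
    apply Subtype.ext
    dsimp only at h
    rw [hr p, hr q, h]

lemma card_properColorings_eq_sum {V : Type*} [Fintype V] (G : SimpleGraph V) (m : ℕ) {N : ℕ}
    (hN : 2 ^ Fintype.card V < N) :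
    (properColorings G m).card
      = ∑ k ∈ Finset.range N, graphStirling G k * m.descFactorial k := by
  classical
  rw [Finset.card_eq_sum_card_fiberwise (f := fiberPartition) (t := stablePartitions G)
      fun f hf => fiberPartition_mem_stablePartitions hf,
    Finset.sum_congr rfl fun P hP => card_filter_fiberPartition_eq m hP,
    ← Finset.sum_fiberwise_of_maps_to (g := Finset.card) (t := Finset.range N)]
  · refine Finset.sum_congr rfl fun k _ => ?_
    rw [Finset.sum_congr rfl (g := fun _ => m.descFactorial k)
      fun P hP => by rw [(Finset.mem_filter.1 hP).2], Finset.sum_const, smul_eq_mul]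
    congr 1
    rw [graphStirling, Nat.card_eq_fintype_card, Fintype.card_subtype, stablePartitions,
      Finset.filter_filter]
    congr 1
    ext P
    simp [and_comm]
  · intro P _
    refine Finset.mem_range.2 (lt_of_le_of_lt (Finset.card_le_univ P) ?_)
    rwa [Fintype.card_finset]

open Classical in
/-- Counting colourings of a graph in which the later neighbours of each vertex `i` are exactly
the vertices in the interval `(i, h i)`, where `h` is monotone. -/
lemma card_colorings_of_monotone (m : ℕ) : ∀ (n : ℕ) (h : ℕ → ℕ),
    (∀ i, h i ≤ h (i + 1)) → (∀ i, h i ≤ n) → (∀ i < n, i < h i) →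
    (((Finset.univ : Finset (Fin n → Fin m)).filter fun f =>
      ∀ i j : Fin n, (i : ℕ) < j → (j : ℕ) < h i → f i ≠ f j).card : ℝ)
      = ∏ i ∈ Finset.range n, ((m : ℝ) - ((h i : ℝ) - i - 1)) := by
  intro n
  induction n with
  | zero => intro h _ _ _; simp
  | succ n ih =>
    intro h hmono hle hlt
    have ih' := ih (fun i => h (i + 1) - 1) (fun i => Nat.sub_le_sub_right (hmono _) 1)
      (fun i => by have := hle (i + 1); omega)
      (fun i hi => by have := hlt (i + 1) (by omega); omega)
    rw [Finset.prod_range_succ']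
    have hprod : ∏ i ∈ Finset.range n, ((m : ℝ) - ((h (i + 1) : ℝ) - ((i + 1 : ℕ) : ℝ) - 1))
        = ∏ i ∈ Finset.range n, ((m : ℝ) - (((h (i + 1) - 1 : ℕ) : ℝ) - i - 1)) := by
      refine Finset.prod_congr rfl fun i hi => ?_
      have := hlt (i + 1) (by have := Finset.mem_range.1 hi; omega)
      rw [Nat.cast_sub (by omega)]
      push_cast
      ring
    rw [hprod, ← ih']
    have hm : Monotone h := monotone_nat_of_le_succ hmono
    have h0 := hlt 0 (by omega)
    have h0n := hle 0
    set A := (Finset.univ : Finset (Fin n → Fin m)).filter fun f =>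
      ∀ i j : Fin n, (i : ℕ) < j → (j : ℕ) < h (i + 1) - 1 → f i ≠ f j with hA
    let B : (Fin n → Fin m) → Finset (Fin m) := fun f =>
      ((Finset.univ.filter fun j : Fin n => (j : ℕ) < h 0 - 1).image f)ᶜ
    have hB : ∀ f ∈ A, ((B f).card : ℝ) = (m : ℝ) - ((h 0 : ℝ) - (0 : ℕ) - 1) := by
      intro f hf
      have hinj : Set.InjOn f
          (Finset.univ.filter fun j : Fin n => (j : ℕ) < h 0 - 1 : Finset (Fin n)) := by
        intro i hi j hj hij
        simp only [Finset.coe_filter, Finset.mem_univ, true_and, Set.mem_ofPred_eq] at hi hj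
        have hf' := (Finset.mem_filter.1 hf).2
        have h1 := hm (Nat.zero_le (i.1 + 1))
        have h2 := hm (Nat.zero_le (j.1 + 1))
        rcases lt_trichotomy i.1 j.1 with hl | he | hl
        · exact absurd hij (hf' i j hl (by omega))
        · exact Fin.ext he
        · exact absurd hij.symm (hf' j i hl (by omega))
      have hcard : (Finset.univ.filter fun j : Fin n => (j : ℕ) < h 0 - 1).card = h 0 - 1 := by
        rw [Fin.card_filter_val_lt]
        omega
      have hle' := Finset.card_le_univ
        ((Finset.univ.filter fun j : Fin n => (j : ℕ) < h 0 - 1).image f)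
      rw [Finset.card_compl, Nat.cast_sub hle', Finset.card_image_of_injOn hinj, hcard,
        Nat.cast_sub (by omega)]
      simp
    have hsig : ((Finset.univ : Finset (Fin (n + 1) → Fin m)).filter fun f =>
        ∀ i j : Fin (n + 1), (i : ℕ) < j → (j : ℕ) < h i → f i ≠ f j).card
        = (A.sigma B).card := by
      refine Finset.card_bij' (fun f _ => ⟨Fin.tail f, f 0⟩)
        (fun p _ => Fin.cons p.2 p.1) ?_ ?_ ?_ ?_
      · intro f hf
        have hf := (Finset.mem_filter.1 hf).2
        simp only [hA, B, Finset.mem_sigma, Finset.mem_filter, Finset.mem_univ, true_and,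
          Finset.mem_compl, Finset.mem_image, not_exists, not_and, Fin.tail]
        refine ⟨fun i j hij hj => hf i.succ j.succ (by simpa using hij) ?_, fun j hj => ?_⟩
        · simp only [Fin.val_succ]
          omega
        · exact (hf 0 j.succ (by simp) (by simp only [Fin.val_succ, Fin.val_zero]; omega)).symm
      · rintro ⟨f, a⟩ hp
        simp only [hA, B, Finset.mem_sigma, Finset.mem_filter, Finset.mem_univ, true_and,
          Finset.mem_compl, Finset.mem_image, not_exists, not_and] at hp
        simp only [Finset.mem_filter, Finset.mem_univ, true_and]
        intro i j hij hj
        induction j using Fin.cases with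
        | zero => simp at hij
        | succ j =>
          induction i using Fin.cases with
          | zero =>
            simp only [Fin.val_succ, Fin.val_zero] at hj
            simpa using fun he => hp.2 j (by omega) he.symm
          | succ i =>
            simp only [Fin.val_succ] at hj hij
            simpa using hp.1 i j (by omega) (by omega)
      · intro f _
        exact Fin.cons_self_tail f
      · rintro ⟨f, a⟩ _
        simp
    rw [hsig, Finset.card_sigma, Nat.cast_sum, Finset.sum_congr rfl hB, Finset.sum_const,
      nsmul_eq_mul]

lemma xsBefore_le_count (w : List Bool) (i : ℕ) : xsBefore w i ≤ w.count true := by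
  induction w generalizing i with
  | nil => simp [xsBefore]
  | cons b w ih =>
    cases i with
    | zero => simp [xsBefore]
    | succ i =>
      cases b
      · have := ih i
        simp only [xsBefore]
        split_ifs <;> simp [*]
      · have := ih (i + 1)
        simpa [xsBefore] using this

lemma xsBefore_le_succ (w : List Bool) (i : ℕ) : xsBefore w i ≤ xsBefore w (i + 1) := by
  induction w generalizing i with
  | nil => simp [xsBefore]
  | cons b w ih =>
    cases i with
    | zero => simp [xsBefore]
    | succ i =>
      cases b
      · have := ih i
        simp only [xsBefore]
        split_ifs <;> simp_all
      · have := ih (i + 1)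
        simpa [xsBefore] using this

lemma lt_add_xsBefore (w : List Bool) (c i : ℕ)
    (hw : ∀ p : ℕ, (w.take p).count false ≤ c + (w.take p).count true)
    (hi : i < w.count false) : i < c + xsBefore w (i + 1) := by
  induction w generalizing c i with
  | nil => simp at hi
  | cons b w ih =>
    cases b
    · have h1 := hw 1
      simp at h1
      cases i with
      | zero => simp [xsBefore]; omega
      | succ i =>
        have := ih (c - 1) i (fun p => by have := hw (p + 1); simp at this; omega)
          (by simp at hi; omega)
        simp only [xsBefore, Nat.add_eq_zero_iff, one_ne_zero, and_false, if_false]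
        omega
    · have := ih (c + 1) i (fun p => by have := hw (p + 1); simp at this; omega)
        (by simpa using hi)
      simp only [xsBefore]
      omega

/-- The scalar by which the word `w` acts on `X ^ m`, up to a shift of the exponent. -/
noncomputable def wordCoeff (w : List Bool) (m : ℕ) : ℝ :=
  ∏ i ∈ Finset.range (w.count false),
    ((m : ℝ) + w.count true - w.count false - xsBefore w (i + 1) + i + 1)

lemma wordCoeff_true_cons (w : List Bool) (m : ℕ) :
    wordCoeff (true :: w) m = wordCoeff w m := by
  simp only [wordCoeff, xsBefore]
  rw [List.count_cons_of_ne (a := false) (by simp), List.count_cons_self]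
  refine Finset.prod_congr rfl fun i _ => ?_
  push_cast
  ring

lemma wordCoeff_false_cons (w : List Bool) (m : ℕ) :
    wordCoeff (false :: w) m
      = wordCoeff w m * ((m : ℝ) + w.count true - w.count false) := by
  simp only [wordCoeff, xsBefore]
  rw [List.count_cons_of_ne (a := true) (by simp), List.count_cons_self, Finset.prod_range_succ']
  congr 1
  · refine Finset.prod_congr rfl fun i _ => ?_
    simp
    ring
  · simp
    ring

lemma wordOp_X_pow (w : List Bool) (m : ℕ) :
    (m + w.count true < w.count false → wordCoeff w m = 0) ∧
      wordOp w (Polynomial.X ^ m)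
        = wordCoeff w m • Polynomial.X ^ (m + w.count true - w.count false) := by
  induction w with
  | nil => simp [wordOp, wordCoeff]
  | cons b w ih =>
    obtain ⟨h0, h1⟩ := ih
    cases b
    · rw [wordCoeff_false_cons, List.count_cons_of_ne (a := true) (by simp), List.count_cons_self]
      constructor
      · intro h
        rcases (Nat.lt_succ_iff.1 h).lt_or_eq with h | h
        · rw [h0 h, zero_mul]
        · have : (m : ℝ) + w.count true = w.count false := by exact_mod_cast h
          rw [this, sub_self, mul_zero]
      · simp only [wordOp, LinearMap.comp_apply, h1, Bool.false_eq_true, if_false, map_smul, dOp,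
          Polynomial.derivative_X_pow]
        rcases lt_or_ge (m + w.count true) (w.count false) with h | h
        · simp [h0 h]
        · rw [Nat.cast_sub h, ← Nat.sub_sub, mul_smul, ← Polynomial.smul_eq_C_mul]
          push_cast
          rfl
    · rw [wordCoeff_true_cons, List.count_cons_of_ne (a := false) (by simp), List.count_cons_self]
      constructor
      · intro h
        exact h0 (by omega)
      · simp only [wordOp, LinearMap.comp_apply, h1, if_true, map_smul, xOp,
          LinearMap.mulLeft_apply]
        rcases lt_or_ge (m + w.count true) (w.count false) with h | h
        · simp [h0 h]
        · rw [← pow_succ', ← Nat.sub_add_comm h, Nat.add_assoc]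

lemma xkDk_X_pow (k m : ℕ) :
    xkDk k (Polynomial.X ^ m) = (m.descFactorial k : ℝ) • Polynomial.X ^ m := by
  have hx : ∀ p : Polynomial ℝ, (xOp ^ k) p = Polynomial.X ^ k * p := fun p => by
    rw [xOp, LinearMap.pow_mulLeft, LinearMap.mulLeft_apply]
  have hd : (dOp ^ k) (Polynomial.X ^ m)
      = (m.descFactorial k : ℝ) • Polynomial.X ^ (m - k) := by
    rw [dOp, Module.End.pow_apply, Polynomial.iterate_derivative_X_pow_eq_smul]
  simp only [xkDk, Int.natCast_nonneg, if_true, Int.toNat_natCast, LinearMap.comp_apply, hx, hd]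
  rcases lt_or_ge m k with h | h
  · simp [Nat.descFactorial_of_lt h]
  · rw [mul_smul_comm, ← pow_add, Nat.add_sub_cancel' h]

lemma eq_zero_of_sum_mul_descFactorial_eq_zero {T : ℕ → ℝ} {N : ℕ}
    (hT : ∀ m : ℕ, ∑ k ∈ Finset.range N, T k * (m.descFactorial k : ℝ) = 0) :
    ∀ k < N, T k = 0 := by
  intro k
  induction k using Nat.strong_induction_on with
  | _ k ih =>
    intro hk
    have h := hT k
    rw [Finset.sum_eq_single k] at h
    · rw [Nat.descFactorial_self] at h
      exact (mul_eq_zero.1 h).resolve_right (by exact_mod_cast k.factorial_ne_zero)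
    · intro j hj hjk
      rcases lt_or_gt_of_ne hjk with hl | hl
      · rw [ih j hl (Finset.mem_range.1 hj), zero_mul]
      · rw [Nat.descFactorial_of_lt hl, Nat.cast_zero, mul_zero]
    · intro h'
      exact absurd (Finset.mem_range.2 hk) h'

lemma IsNormalOrder.exists_sum_eq_wordCoeff {w : List Bool} {S : ℤ → ℝ} (hS : IsNormalOrder w S)
    (hw : w.count true = w.count false) :
    ∃ N₀ : ℕ, ∀ N ≥ N₀, ∀ m : ℕ,
      ∑ k ∈ Finset.range N, S k * (m.descFactorial k : ℝ) = wordCoeff w m := by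
  obtain ⟨hfin, hneg, hop⟩ := hS
  obtain ⟨M, hM⟩ := hfin.bddAbove
  refine ⟨M.toNat + 1, fun N hN m => ?_⟩
  have hsub : (Function.support fun k : ℤ => S k • xkDk k)
      ⊆ ((Finset.range N).map Nat.castEmbedding : Finset ℤ) := by
    intro k hk
    have hk' : S k ≠ 0 := fun h => hk (by simp [h])
    have hkM : k ≤ M := hM hk'
    have hk0 : 0 ≤ k := not_lt.1 fun h => hk' (hneg k h)
    simp only [Finset.coe_map, Set.mem_image, Finset.mem_coe, Finset.mem_range]
    exact ⟨k.toNat, by omega, by simp [hk0]⟩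
  rw [finsum_eq_sum_of_support_subset _ hsub, Finset.sum_map] at hop
  have h := congrArg (fun F => Polynomial.coeff (F (Polynomial.X ^ m)) m) hop
  simp only [(wordOp_X_pow w m).2, hw, Nat.add_sub_cancel, LinearMap.sum_apply,
    LinearMap.smul_apply, Nat.castEmbedding_apply, xkDk_X_pow, Polynomial.finsetSum_coeff,
    Polynomial.coeff_smul, Polynomial.coeff_X_pow_self, smul_eq_mul, mul_one] at h
  exact h.symm

lemma card_properColorings_cliqueUnionGraph {w : List Bool} (hw : IsDyck w) (m : ℕ) :
    ((properColorings (cliqueUnionGraph w) m).card : ℝ) = wordCoeff w m := by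
  classical
  have h := card_colorings_of_monotone m (w.count true) (fun i => xsBefore w (i + 1))
    (fun i => xsBefore_le_succ w _) (fun i => xsBefore_le_count w _)
    (fun i hi => by
      have := lt_add_xsBefore w 0 i (by simpa using hw.2) (hw.1 ▸ hi)
      simpa using this)
  have hset : properColorings (cliqueUnionGraph w) m
      = (Finset.univ : Finset (Fin (w.count true) → Fin m)).filter fun f =>
        ∀ i j : Fin (w.count true), (i : ℕ) < j → (j : ℕ) < xsBefore w (i + 1) → f i ≠ f j := by
    ext f
    simp only [properColorings, cliqueUnionGraph, Finset.mem_filter, Finset.mem_univ, true_and,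
      SimpleGraph.fromRel_adj]
    constructor
    · intro hf i j hij hj
      exact hf i j ⟨fun he => by simp [he] at hij, Or.inl ⟨hij, hj⟩⟩
    · rintro hf i j ⟨-, ⟨hij, hj⟩ | ⟨hij, hj⟩⟩
      · exact hf i j hij hj
      · exact (hf j i hij hj).symm
  rw [hset, h, wordCoeff, hw.1]
  refine Finset.prod_congr rfl fun i _ => ?_
  ring

/-- For every Dyck word `w` and integer `k`, the normal order coefficient `S_w(k)` equals the
graph Stirling number of the clique-union graph `H_w`. -/
theorem normalOrder_eq_graphStirling_cliqueUnion (w : List Bool) (hw : IsDyck w)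
    (S : ℤ → ℝ) (hS : IsNormalOrder w S) (k : ℤ) :
    S k = if 0 ≤ k then (graphStirling (cliqueUnionGraph w) k.toNat : ℝ) else 0 := by
  obtain ⟨N₀, hN₀⟩ := hS.exists_sum_eq_wordCoeff hw.1
  split_ifs with hk
  · lift k to ℕ using hk
    obtain ⟨c, hc⟩ : ∃ c, 2 ^ Fintype.card (Fin (w.count true)) = c := ⟨_, rfl⟩
    obtain ⟨N, hN⟩ : ∃ N, N = N₀ + c + k + 1 := ⟨_, rfl⟩
    have hT := eq_zero_of_sum_mul_descFactorial_eq_zero (N := N)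
      (T := fun k => S k - graphStirling (cliqueUnionGraph w) k) (fun m => by
        have h := card_properColorings_cliqueUnionGraph hw m
        rw [card_properColorings_eq_sum (N := N) _ m (by omega)] at h
        push_cast at h
        simp only [sub_mul, Finset.sum_sub_distrib]
        rw [hN₀ N (by omega) m, h, sub_self]) k (by omega)
    simpa using sub_eq_zero.1 hT
  · exact hS.2.1 k (not_le.1 hk)
end
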